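/- arXiv:2411.15810 — 3 statements merged into one kernel-verified Lean document; each statement's English description precedes it below -/
import Mathlib

section
/- Let n ≥ 1, l ≥ 1 be integers and R, T > 0. Let a_{2l+1} = diag(a_{(2l+1)i}) and a_{2l} = diag(a_{(2l)i}) be constant diagonal n×n real matrices, and for j = 0,…,2l−1 let a_j(t,x) = (a_{jim}(t,x)) be n×n matrix functions, smooth on [0,T] × [0,R]. Let f, G₀, …, G_l : [0,T] × [0,R] → ℝⁿ be smooth, and let u : [0,T] × [0,R] → ℝⁿ be smooth and satisfy ∂_t u − (−1)^l ( a_{2l+1} ∂_x^{2l+1} u + a_{2l} ∂_x^{2l} u ) − Σ_{j=0}^{l−1} (−1)^j ∂_x^j [ a_{2j+1}(t,x) ∂_x^{j+1} u + a_{2j}(t,x) ∂_x^{j} u ] = f + Σ_{j=0}^{l} (−1)^j ∂_x^j G_j on [0,T] × [0,R]. Set μ_k(t) = ∂_x^k u(t,0) for k = 0,…,l−1 and ν_k(t) = ∂_x^k u(t,R) for k = 0,…,l. Let ω : [0,R] → ℝ be 2l+1 times continuously differentiable with ω^{(m)}(0) = 0 for m = 0,…,l and ω^{(m)}(R) = 0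 for m = 0,…,l−1. Then for each i = 1,…,n and every t ∈ [0,T], d/dt ∫₀^R u_i(t,x) ω(x) dx = ν_{li}(t) a_{(2l+1)i} ω^{(l)}(R) + Σ_{k=0}^{l−1} (−1)^{l+k} [ ν_{ki}(t) ( a_{(2l+1)i} ω^{(2l−k)}(R) − a_{(2l)i} ω^{(2l−k−1)}(R) ) − μ_{ki}(t) ( a_{(2l+1)i} ω^{(2l−k)}(0) − a_{(2l)i} ω^{(2l−k−1)}(0) ) ] + Σ_{m=1}^{n} Σ_{j=0}^{l−1} Σ_{k=0}^{j−1} (−1)^{j+k} [ ν_{km}(t) ( (a_{(2j+1)im} ω^{(j)})^{(j−k)}(R) − (a_{(2j)im} ω^{(j)})^{(j−k−1)}(R) ) − μ_{km}(t) ( (a_{(2j+1)im} ω^{(j)})^{(j−k)}(0) − (a_{(2j)im} ω^{(j)})^{(j−k−1)}(0) ) ] + (−1)^{l+1} ∫₀^R u_i(t,x) ( a_{(2l+1)i} ω^{(2l+1)}(x) − a_{(2l)i} ω^{(2l)}(x) ) dx + Σ_{m=1}^{n} Σ_{j=0}^{l−1} (−1)^{j+1} ∫₀^R u_m(t,x)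 [ (a_{(2j+1)im} ω^{(j)})^{(j+1)}(x) − (a_{(2j)im} ω^{(j)})^{(j)}(x) ] dx + ∫₀^R f_i(t,x) ω(x) dx + Σ_{j=0}^{l} ∫₀^R G_{ji}(t,x) ω^{(j)}(x) dx. -/
open MeasureTheory Set

/-- If `f` is `C^(N + k)`, then its `k`-th derivative is `C^N`. -/
theorem contDiff_iteratedDeriv_of_add {f : ℝ → ℝ} {N k : ℕ} (hf : ContDiff ℝ (N + k : ℕ) f) :
    ContDiff ℝ N (iteratedDeriv k f) := by
  rw [iteratedDeriv_eq_iterate]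
  exact ContDiff.iterate_deriv' N k hf

/-- Repeated integration by parts on an interval, with all boundary terms. -/
theorem integral_iteratedDeriv_mul (N : ℕ) {v φ : ℝ → ℝ} (hv : ContDiff ℝ N v)
    (hφ : ContDiff ℝ N φ) (a b : ℝ) :
    ∫ x in a..b, iteratedDeriv N v x * φ x =
      (∑ k ∈ Finset.range N, (-1 : ℝ) ^ (N + 1 + k) *
        (iteratedDeriv k v b * iteratedDeriv (N - 1 - k) φ b -
          iteratedDeriv k v a * iteratedDeriv (N - 1 - k) φ a)) +
      (-1 : ℝ) ^ N * ∫ x in a..b, v x * iteratedDeriv N φ x := by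
  induction N generalizing φ with
  | zero => simp
  | succ N ih =>
    have hφ1 : ContDiff ℝ N (deriv φ) := (contDiff_succ_iff_deriv.mp hφ).2.2
    have hφd : Differentiable ℝ φ := hφ.differentiable (by simp)
    have hvd : Differentiable ℝ (iteratedDeriv N v) := hv.differentiable_iteratedDeriv' N
    have hparts := intervalIntegral.integral_mul_deriv_eq_deriv_mul (a := a) (b := b)
      (fun x _ => (hvd x).hasDerivAt) (fun x _ => (hφd x).hasDerivAt)
      (by rw [← iteratedDeriv_succ]
          exact (hv.continuous_iteratedDeriv' _).intervalIntegrable _ _)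
      (hφ1.continuous.intervalIntegrable _ _)
    rw [ih (hv.of_le (by exact_mod_cast N.le_succ)) hφ1, ← iteratedDeriv_succ] at hparts
    rw [Finset.sum_range_succ, iteratedDeriv_succ' (f := φ)]
    have hsum : ∑ k ∈ Finset.range N, (-1 : ℝ) ^ (N + 1 + 1 + k) *
          (iteratedDeriv k v b * iteratedDeriv (N + 1 - 1 - k) φ b -
            iteratedDeriv k v a * iteratedDeriv (N + 1 - 1 - k) φ a) =
        -∑ k ∈ Finset.range N, (-1 : ℝ) ^ (N + 1 + k) *
          (iteratedDeriv k v b * iteratedDeriv (N - 1 - k) (deriv φ) b -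
            iteratedDeriv k v a * iteratedDeriv (N - 1 - k) (deriv φ) a) := by
      rw [← Finset.sum_neg_distrib]
      refine Finset.sum_congr rfl fun k hk => ?_
      have hk := Finset.mem_range.mp hk
      rw [show N + 1 - 1 - k = (N - 1 - k) + 1 by omega, iteratedDeriv_succ']
      ring
    have hsign : (-1 : ℝ) ^ (N + 1 + 1 + N) = 1 := by
      rw [show N + 1 + 1 + N = 2 * (N + 1) by ring, pow_mul]; simp
    rw [hsum, hsign, pow_succ]
    simp only [add_tsub_cancel_right, tsub_self, iteratedDeriv_zero]
    linarith

/-- Repeated integration by parts when the first `M` derivatives (from order `0` on) of the second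
factor vanish at both end points. -/
theorem integral_iteratedDeriv_mul_of_vanish (K M N : ℕ) (hN : N = K + M) {v φ : ℝ → ℝ}
    (hv : ContDiff ℝ N v) (hφ : ContDiff ℝ N φ) {a b : ℝ}
    (ha : ∀ p < M, iteratedDeriv p φ a = 0) (hb : ∀ p < M, iteratedDeriv p φ b = 0) :
    ∫ x in a..b, iteratedDeriv N v x * φ x =
      (∑ k ∈ Finset.range K, (-1 : ℝ) ^ (N + 1 + k) *
        (iteratedDeriv k v b * iteratedDeriv (N - 1 - k) φ b -
          iteratedDeriv k v a * iteratedDeriv (N - 1 - k) φ a)) +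
      (-1 : ℝ) ^ N * ∫ x in a..b, v x * iteratedDeriv N φ x := by
  rw [integral_iteratedDeriv_mul N hv hφ]
  congr 1
  symm
  refine Finset.sum_subset (Finset.range_mono (by omega)) fun k hk hk' => ?_
  rw [Finset.mem_range] at hk hk'
  rw [ha _ (by omega), hb _ (by omega)]
  ring

/-- Differentiation under the integral sign for a smooth function of two variables times a
continuous weight. -/
theorem hasDerivAt_intervalIntegral_mul {v : ℝ → ℝ → ℝ}
    (hv : ContDiff ℝ 1 fun p : ℝ × ℝ => v p.1 p.2) {w : ℝ → ℝ} (hw : Continuous w) (a b t : ℝ) :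
    HasDerivAt (fun s => ∫ x in a..b, v s x * w x)
      (∫ x in a..b, deriv (fun s => v s x) t * w x) t := by
  have hderiv : ∀ s x, HasDerivAt (fun s => v s x)
      (fderiv ℝ (fun p : ℝ × ℝ => v p.1 p.2) (s, x) (1, 0)) s := fun s x =>
    ((hv.differentiable one_ne_zero (s, x)).hasFDerivAt).comp_hasDerivAt
      (f := fun s : ℝ => (s, x)) s ((hasDerivAt_id s).prodMk (hasDerivAt_const s x))
  have hcont : Continuous fun p : ℝ × ℝ => deriv (fun s => v s p.2) p.1 * w p.2 := by
    simp_rw [(hderiv _ _).deriv]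
    exact ((hv.continuous_fderiv one_ne_zero).clm_apply continuous_const).mul
      (hw.comp continuous_snd)
  obtain ⟨C, hC⟩ := ((isCompact_Icc (a := t - 1) (b := t + 1)).prod
    (isCompact_uIcc (a := a) (b := b))).exists_bound_of_continuousOn hcont.continuousOn
  have hvs : ∀ s, Continuous fun x => v s x * w x := fun s =>
    (hv.continuous.comp (by fun_prop : Continuous fun x : ℝ => (s, x))).mul hw
  refine (intervalIntegral.hasDerivAt_integral_of_dominated_loc_of_deriv_le
    (F := fun s x => v s x * w x) (F' := fun s x => deriv (fun s => v s x) s * w x)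
    (bound := fun _ => C) (Icc_mem_nhds (by linarith : t - 1 < t) (by linarith : t < t + 1))
    (.of_forall fun s => (hvs s).aestronglyMeasurable) ((hvs t).intervalIntegrable _ _)
    (hcont.comp (by fun_prop : Continuous fun x : ℝ => (t, x))).aestronglyMeasurable
    (.of_forall fun x hx s hs => hC (s, x) ⟨hs, uIoc_subset_uIcc hx⟩)
    intervalIntegrable_const (.of_forall fun x _ s _ => ?_)).2
  exact ((hderiv s x).differentiableAt.hasDerivAt).mul_const _

/-- The contribution of the two leading terms, tested against `ω`. -/
theorem integral_leading_terms_mul {l : ℕ} {R : ℝ} (A B : ℝ) {v ω : ℝ → ℝ}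
    (hv : ContDiff ℝ (⊤ : ℕ∞) v) (hω : ContDiff ℝ (2 * l + 1 : ℕ) ω)
    (hω0 : ∀ m ≤ l, iteratedDeriv m ω 0 = 0) (hωR : ∀ m < l, iteratedDeriv m ω R = 0) :
    (-1 : ℝ) ^ l * (A * (∫ x in (0:ℝ)..R, iteratedDeriv (2 * l + 1) v x * ω x) +
        B * ∫ x in (0:ℝ)..R, iteratedDeriv (2 * l) v x * ω x) =
      iteratedDeriv l v R * A * iteratedDeriv l ω R +
      (∑ k ∈ Finset.range l, (-1 : ℝ) ^ (l + k) *
        (iteratedDeriv k v R *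
            (A * iteratedDeriv (2 * l - k) ω R - B * iteratedDeriv (2 * l - k - 1) ω R) -
          iteratedDeriv k v 0 *
            (A * iteratedDeriv (2 * l - k) ω 0 - B * iteratedDeriv (2 * l - k - 1) ω 0))) +
      (-1 : ℝ) ^ (l + 1) * (∫ x in (0:ℝ)..R, v x *
        (A * iteratedDeriv (2 * l + 1) ω x - B * iteratedDeriv (2 * l) ω x)) := by
  have hω' : ContDiff ℝ (2 * l : ℕ) ω := hω.of_le (by exact_mod_cast (2 * l).le_succ)
  have c1 := hω.continuous_iteratedDeriv' (2 * l + 1)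
  have c0 := hω'.continuous_iteratedDeriv' (2 * l)
  have cv := hv.continuous
  have hint : ∫ x in (0:ℝ)..R, v x *
        (A * iteratedDeriv (2 * l + 1) ω x - B * iteratedDeriv (2 * l) ω x) =
      A * (∫ x in (0:ℝ)..R, v x * iteratedDeriv (2 * l + 1) ω x) -
        B * ∫ x in (0:ℝ)..R, v x * iteratedDeriv (2 * l) ω x := by
    rw [← intervalIntegral.integral_const_mul, ← intervalIntegral.integral_const_mul,
      ← intervalIntegral.integral_sub ((by fun_prop : Continuous _).intervalIntegrable _ _)
        ((by fun_prop : Continuous _).intervalIntegrable _ _)]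
    exact intervalIntegral.integral_congr fun x _ => by ring
  rw [integral_iteratedDeriv_mul_of_vanish (l + 1) l (2 * l + 1) (by ring)
      (contDiff_infty.mp hv _) hω (fun p hp => hω0 p hp.le) hωR,
    integral_iteratedDeriv_mul_of_vanish l l (2 * l) (by ring)
      (contDiff_infty.mp hv _) hω' (fun p hp => hω0 p hp.le) hωR,
    hint, Finset.sum_range_succ, show 2 * l + 1 - 1 - l = l by omega, hω0 l le_rfl]
  have hsq : (-1 : ℝ) ^ l * (-1 : ℝ) ^ l = 1 := by rw [← mul_pow]; simp
  have he : (-1 : ℝ) ^ (2 * l) = 1 := by rw [pow_mul]; simp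
  have hsum : ∑ k ∈ Finset.range l, (-1 : ℝ) ^ (l + k) *
        (iteratedDeriv k v R *
            (A * iteratedDeriv (2 * l - k) ω R - B * iteratedDeriv (2 * l - k - 1) ω R) -
          iteratedDeriv k v 0 *
            (A * iteratedDeriv (2 * l - k) ω 0 - B * iteratedDeriv (2 * l - k - 1) ω 0)) =
      (-1 : ℝ) ^ l * (A * (∑ k ∈ Finset.range l, (-1 : ℝ) ^ (2 * l + 1 + 1 + k) *
        (iteratedDeriv k v R * iteratedDeriv (2 * l + 1 - 1 - k) ω R -
          iteratedDeriv k v 0 * iteratedDeriv (2 * l + 1 - 1 - k) ω 0)) +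
      B * ∑ k ∈ Finset.range l, (-1 : ℝ) ^ (2 * l + 1 + k) *
        (iteratedDeriv k v R * iteratedDeriv (2 * l - 1 - k) ω R -
          iteratedDeriv k v 0 * iteratedDeriv (2 * l - 1 - k) ω 0)) := by
    simp only [Finset.mul_sum, ← Finset.sum_add_distrib]
    refine Finset.sum_congr rfl fun k _ => ?_
    rw [Nat.sub_right_comm (2 * l) 1 k, add_tsub_cancel_right]
    simp only [pow_add, he]
    ring
  rw [hsum]
  simp only [pow_add, he]
  linear_combination (A * iteratedDeriv l v R * iteratedDeriv l ω R) * hsq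

/-- The contribution of one pair of variable coefficients `p`, `q` of the order `j` term, tested
against `ψ`, the `j`-th derivative of the weight, which vanishes at both end points. -/
theorem integral_lower_terms_mul {j : ℕ} {R : ℝ} {p q v ψ : ℝ → ℝ}
    (hp : ContDiff ℝ (⊤ : ℕ∞) p) (hq : ContDiff ℝ (⊤ : ℕ∞) q) (hv : ContDiff ℝ (⊤ : ℕ∞) v)
    (hψ : ContDiff ℝ (j + 1 : ℕ) ψ) (hψ0 : ψ 0 = 0) (hψR : ψ R = 0) :
    (∫ x in (0:ℝ)..R, (p x * iteratedDeriv (j + 1) v x + q x * iteratedDeriv j v x) * ψ x) =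
      (∑ k ∈ Finset.range j, (-1 : ℝ) ^ (j + k) *
        (iteratedDeriv k v R *
            (iteratedDeriv (j - k) (fun y => p y * ψ y) R -
              iteratedDeriv (j - k - 1) (fun y => q y * ψ y) R) -
          iteratedDeriv k v 0 *
            (iteratedDeriv (j - k) (fun y => p y * ψ y) 0 -
              iteratedDeriv (j - k - 1) (fun y => q y * ψ y) 0))) +
      (-1 : ℝ) ^ (j + 1) * ∫ x in (0:ℝ)..R, v x *
        (iteratedDeriv (j + 1) (fun y => p y * ψ y) x -
          iteratedDeriv j (fun y => q y * ψ y) x) := by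
  have hψ' : ContDiff ℝ j ψ := hψ.of_le (by exact_mod_cast j.le_succ)
  have hP : ContDiff ℝ (j + 1 : ℕ) (fun y => p y * ψ y) :=
    (contDiff_infty.mp hp _).mul hψ
  have hQ : ContDiff ℝ j (fun y => q y * ψ y) := (contDiff_infty.mp hq _).mul hψ'
  have hv1 : ContDiff ℝ (j + 1 : ℕ) v := contDiff_infty.mp hv _
  have hv0 : ContDiff ℝ j v := contDiff_infty.mp hv _
  have cP := hP.continuous_iteratedDeriv' (j + 1)
  have cQ := hQ.continuous_iteratedDeriv' j
  have cv1 := hv1.continuous_iteratedDeriv' (j + 1)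
  have cv0 := hv0.continuous_iteratedDeriv' j
  have cv := hv.continuous
  have cp := hp.continuous
  have cq := hq.continuous
  have cψ := hψ.continuous
  have hleft : (∫ x in (0:ℝ)..R,
        (p x * iteratedDeriv (j + 1) v x + q x * iteratedDeriv j v x) * ψ x) =
      (∫ x in (0:ℝ)..R, iteratedDeriv (j + 1) v x * (p x * ψ x)) +
        ∫ x in (0:ℝ)..R, iteratedDeriv j v x * (q x * ψ x) := by
    rw [← intervalIntegral.integral_add ((by fun_prop : Continuous _).intervalIntegrable _ _)
        ((by fun_prop : Continuous _).intervalIntegrable _ _)]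
    exact intervalIntegral.integral_congr fun x _ => by ring
  have hright : (∫ x in (0:ℝ)..R, v x *
        (iteratedDeriv (j + 1) (fun y => p y * ψ y) x -
          iteratedDeriv j (fun y => q y * ψ y) x)) =
      (∫ x in (0:ℝ)..R, v x * iteratedDeriv (j + 1) (fun y => p y * ψ y) x) -
        ∫ x in (0:ℝ)..R, v x * iteratedDeriv j (fun y => q y * ψ y) x := by
    rw [← intervalIntegral.integral_sub ((by fun_prop : Continuous _).intervalIntegrable _ _)
        ((by fun_prop : Continuous _).intervalIntegrable _ _)]
    exact intervalIntegral.integral_congr fun x _ => by ring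
  rw [hleft, hright, integral_iteratedDeriv_mul_of_vanish j 1 (j + 1) rfl hv1 hP
      (fun r hr => by simp [Nat.lt_one_iff.mp hr, hψ0])
      (fun r hr => by simp [Nat.lt_one_iff.mp hr, hψR]),
    integral_iteratedDeriv_mul j hv0 hQ]
  have hsum : ∑ k ∈ Finset.range j, (-1 : ℝ) ^ (j + k) *
        (iteratedDeriv k v R *
            (iteratedDeriv (j - k) (fun y => p y * ψ y) R -
              iteratedDeriv (j - k - 1) (fun y => q y * ψ y) R) -
          iteratedDeriv k v 0 *
            (iteratedDeriv (j - k) (fun y => p y * ψ y) 0 -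
              iteratedDeriv (j - k - 1) (fun y => q y * ψ y) 0)) =
      (∑ k ∈ Finset.range j, (-1 : ℝ) ^ (j + 1 + 1 + k) *
        (iteratedDeriv k v R * iteratedDeriv (j + 1 - 1 - k) (fun y => p y * ψ y) R -
          iteratedDeriv k v 0 * iteratedDeriv (j + 1 - 1 - k) (fun y => p y * ψ y) 0)) +
      ∑ k ∈ Finset.range j, (-1 : ℝ) ^ (j + 1 + k) *
        (iteratedDeriv k v R * iteratedDeriv (j - 1 - k) (fun y => q y * ψ y) R -
          iteratedDeriv k v 0 * iteratedDeriv (j - 1 - k) (fun y => q y * ψ y) 0) := by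
    rw [← Finset.sum_add_distrib]
    refine Finset.sum_congr rfl fun k _ => ?_
    rw [Nat.sub_right_comm j 1 k, add_tsub_cancel_right]
    ring
  rw [hsum]
  ring

/-- If the derivatives of `ω` below order `j` vanish at the end points, then `j` derivatives can be
moved onto `ω` without boundary terms. -/
theorem neg_one_pow_mul_integral_iteratedDeriv_mul {j : ℕ} {a b : ℝ} {g ω : ℝ → ℝ}
    (hg : ContDiff ℝ j g) (hω : ContDiff ℝ j ω)
    (ha : ∀ p < j, iteratedDeriv p ω a = 0) (hb : ∀ p < j, iteratedDeriv p ω b = 0) :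
    (-1 : ℝ) ^ j * (∫ x in a..b, iteratedDeriv j g x * ω x) =
      ∫ x in a..b, g x * iteratedDeriv j ω x := by
  rw [integral_iteratedDeriv_mul_of_vanish 0 j j (by simp) hg hω ha hb]
  simp [← mul_assoc, ← mul_pow]

/-- Identity (2.17) of Lemma 2.3 of the paper, for smooth classical solutions.
Here `A i`, `B i` are the diagonal entries of the constant matrices `a_{2l+1}`, `a_{2l}`,
`a j i m` is the `(i,m)` entry of the matrix coefficient `a_j`, `j = 0,…,2l−1`,
`μ_k(t) = ∂ₓᵏu(t,0)` and `ν_k(t) = ∂ₓᵏu(t,R)` are expressed directly through `u`. -/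
theorem integral_overdetermination_derivative_identity
    (n l : ℕ) (hn : 1 ≤ n) (hl : 1 ≤ l) (R T : ℝ) (hR : 0 < R) (hT : 0 < T)
    (A B : Fin n → ℝ)
    (a : ℕ → Fin n → Fin n → ℝ → ℝ → ℝ)
    (ha : ∀ j < 2 * l, ∀ i m : Fin n, ContDiff ℝ (⊤ : ℕ∞) fun p : ℝ × ℝ => a j i m p.1 p.2)
    (f : Fin n → ℝ → ℝ → ℝ) (G : ℕ → Fin n → ℝ → ℝ → ℝ) (u : Fin n → ℝ → ℝ → ℝ)
    (hf : ∀ i, ContDiff ℝ (⊤ : ℕ∞) fun p : ℝ × ℝ => f i p.1 p.2)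
    (hG : ∀ j ≤ l, ∀ i, ContDiff ℝ (⊤ : ℕ∞) fun p : ℝ × ℝ => G j i p.1 p.2)
    (hu : ∀ i, ContDiff ℝ (⊤ : ℕ∞) fun p : ℝ × ℝ => u i p.1 p.2)
    (heq : ∀ i, ∀ t ∈ Icc (0:ℝ) T, ∀ x ∈ Icc (0:ℝ) R,
      deriv (fun s => u i s x) t -
          (-1 : ℝ) ^ l * (A i * iteratedDeriv (2 * l + 1) (u i t) x +
            B i * iteratedDeriv (2 * l) (u i t) x) -
          ∑ j ∈ Finset.range l, (-1 : ℝ) ^ j *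
            iteratedDeriv j (fun y => ∑ m : Fin n,
              (a (2 * j + 1) i m t y * iteratedDeriv (j + 1) (u m t) y +
                a (2 * j) i m t y * iteratedDeriv j (u m t) y)) x =
        f i t x +
          ∑ j ∈ Finset.range (l + 1), (-1 : ℝ) ^ j * iteratedDeriv j (G j i t) x)
    (ω : ℝ → ℝ) (hω : ContDiff ℝ (2 * l + 1 : ℕ) ω)
    (hω0 : ∀ m ≤ l, iteratedDeriv m ω 0 = 0)
    (hωR : ∀ m < l, iteratedDeriv m ω R = 0) :
    ∀ i : Fin n, ∀ t ∈ Icc (0:ℝ) T,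
      deriv (fun s => ∫ x in (0:ℝ)..R, u i s x * ω x) t =
        iteratedDeriv l (u i t) R * A i * iteratedDeriv l ω R +
        (∑ k ∈ Finset.range l, (-1 : ℝ) ^ (l + k) *
          (iteratedDeriv k (u i t) R *
              (A i * iteratedDeriv (2 * l - k) ω R - B i * iteratedDeriv (2 * l - k - 1) ω R) -
            iteratedDeriv k (u i t) 0 *
              (A i * iteratedDeriv (2 * l - k) ω 0 - B i * iteratedDeriv (2 * l - k - 1) ω 0))) +
        (∑ m : Fin n, ∑ j ∈ Finset.range l, ∑ k ∈ Finset.range j, (-1 : ℝ) ^ (j + k) *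
          (iteratedDeriv k (u m t) R *
              (iteratedDeriv (j - k)
                  (fun y => a (2 * j + 1) i m t y * iteratedDeriv j ω y) R -
                iteratedDeriv (j - k - 1)
                  (fun y => a (2 * j) i m t y * iteratedDeriv j ω y) R) -
            iteratedDeriv k (u m t) 0 *
              (iteratedDeriv (j - k)
                  (fun y => a (2 * j + 1) i m t y * iteratedDeriv j ω y) 0 -
                iteratedDeriv (j - k - 1)
                  (fun y => a (2 * j) i m t y * iteratedDeriv j ω y) 0))) +
        (-1 : ℝ) ^ (l + 1) *
          (∫ x in (0:ℝ)..R, u i t x *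
            (A i * iteratedDeriv (2 * l + 1) ω x - B i * iteratedDeriv (2 * l) ω x)) +
        (∑ m : Fin n, ∑ j ∈ Finset.range l, (-1 : ℝ) ^ (j + 1) *
          ∫ x in (0:ℝ)..R, u m t x *
            (iteratedDeriv (j + 1)
                (fun y => a (2 * j + 1) i m t y * iteratedDeriv j ω y) x -
              iteratedDeriv j (fun y => a (2 * j) i m t y * iteratedDeriv j ω y) x)) +
        (∫ x in (0:ℝ)..R, f i t x * ω x) +
        ∑ j ∈ Finset.range (l + 1), ∫ x in (0:ℝ)..R, G j i t x * iteratedDeriv j ω x := by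
  intro i t ht
  have hsec {w : ℝ → ℝ → ℝ} (hw : ContDiff ℝ (⊤ : ℕ∞) fun p : ℝ × ℝ => w p.1 p.2) :
      ContDiff ℝ (⊤ : ℕ∞) (w t) :=
    hw.comp (contDiff_const.prodMk contDiff_id : ContDiff ℝ (⊤ : ℕ∞) fun x : ℝ => (t, x))
  have hle (N : ℕ) : (N : WithTop ℕ∞) ≤ ((⊤ : ℕ∞) : WithTop ℕ∞) := by exact_mod_cast le_top
  have huD (m : Fin n) (N K : ℕ) : ContDiff ℝ N (iteratedDeriv K (u m t)) :=
    contDiff_iteratedDeriv_of_add ((hsec (hu m)).of_le (hle _))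
  have hωD (j : ℕ) (hj : j ≤ l) : ContDiff ℝ (j + 1 : ℕ) (iteratedDeriv j ω) :=
    contDiff_iteratedDeriv_of_add (hω.of_le (by exact_mod_cast (by omega)))
  have hωj (j : ℕ) (hj : j ≤ l) : ContDiff ℝ j ω :=
    hω.of_le (by exact_mod_cast (by omega))
  set h : ℕ → ℝ → ℝ := fun j y => ∑ m : Fin n,
    (a (2 * j + 1) i m t y * iteratedDeriv (j + 1) (u m t) y +
      a (2 * j) i m t y * iteratedDeriv j (u m t) y) with hh
  have hhj (j : ℕ) (hj : j < l) : ContDiff ℝ j (h j) :=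
    ContDiff.sum fun m _ =>
      (((hsec (ha _ (by omega) i m)).of_le (hle _)).mul (huD _ _ _)).add
        (((hsec (ha _ (by omega) i m)).of_le (hle _)).mul (huD _ _ _))
  have cω := hω.continuous
  have cf := (hsec (hf i)).continuous
  have cu1 := (huD i 0 (2 * l + 1)).continuous
  have cu0 := (huD i 0 (2 * l)).continuous
  have ch (j : ℕ) (hj : j ∈ Finset.range l) : Continuous (iteratedDeriv j (h j)) :=
    (hhj j (Finset.mem_range.mp hj)).continuous_iteratedDeriv' j
  have cG (j : ℕ) (hj : j ∈ Finset.range (l + 1)) : Continuous (iteratedDeriv j (G j i t)) :=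
    ((hsec (hG j (Nat.lt_succ_iff.mp (Finset.mem_range.mp hj)) i)).of_le
      (hle _)).continuous_iteratedDeriv' j
  have hsplit : ∫ x in (0:ℝ)..R, deriv (fun s => u i s x) t * ω x =
      (-1 : ℝ) ^ l * (A i * (∫ x in (0:ℝ)..R, iteratedDeriv (2 * l + 1) (u i t) x * ω x) +
        B i * ∫ x in (0:ℝ)..R, iteratedDeriv (2 * l) (u i t) x * ω x) +
      (∑ j ∈ Finset.range l, (-1 : ℝ) ^ j * ∫ x in (0:ℝ)..R, iteratedDeriv j (h j) x * ω x) +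
      (∫ x in (0:ℝ)..R, f i t x * ω x) +
      ∑ j ∈ Finset.range (l + 1),
        (-1 : ℝ) ^ j * ∫ x in (0:ℝ)..R, iteratedDeriv j (G j i t) x * ω x := by
    have sum_out {N : ℕ} {g : ℕ → ℝ → ℝ} (hg : ∀ j ∈ Finset.range N, Continuous (g j)) :
        ∑ j ∈ Finset.range N, ∫ x in (0:ℝ)..R, (-1 : ℝ) ^ j * (g j x * ω x) =
          ∫ x in (0:ℝ)..R, ∑ j ∈ Finset.range N, (-1 : ℝ) ^ j * (g j x * ω x) :=
      (intervalIntegral.integral_finsetSum fun j hj =>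
        (continuous_const.mul ((hg j hj).mul cω)).intervalIntegrable _ _).symm
    simp only [← intervalIntegral.integral_const_mul]
    rw [sum_out ch, sum_out cG]
    have i1 : Continuous fun x => ∑ j ∈ Finset.range l,
        (-1 : ℝ) ^ j * (iteratedDeriv j (h j) x * ω x) :=
      continuous_finsetSum _ fun j hj => ((ch j hj).mul cω).const_smul ((-1 : ℝ) ^ j)
    have i2 : Continuous fun x => ∑ j ∈ Finset.range (l + 1),
        (-1 : ℝ) ^ j * (iteratedDeriv j (G j i t) x * ω x) :=
      continuous_finsetSum _ fun j hj => ((cG j hj).mul cω).const_smul ((-1 : ℝ) ^ j)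
    rw [← intervalIntegral.integral_add ((by fun_prop : Continuous _).intervalIntegrable _ _)
        ((by fun_prop : Continuous _).intervalIntegrable _ _),
      ← intervalIntegral.integral_const_mul,
      ← intervalIntegral.integral_add ((by fun_prop : Continuous _).intervalIntegrable _ _)
        (i1.intervalIntegrable _ _),
      ← intervalIntegral.integral_add ((by fun_prop : Continuous _).intervalIntegrable _ _)
        ((by fun_prop : Continuous _).intervalIntegrable _ _),
      ← intervalIntegral.integral_add ((by fun_prop : Continuous _).intervalIntegrable _ _)
        (i2.intervalIntegrable _ _)]
    refine intervalIntegral.integral_congr fun x hx => ?_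
    rw [uIcc_of_le hR.le] at hx
    have hpde := heq i t ht x hx
    simp only [← mul_assoc, ← Finset.sum_mul]
    linear_combination ω x * hpde
  have hlower (j : ℕ) (hj : j ∈ Finset.range l) :
      (-1 : ℝ) ^ j * (∫ x in (0:ℝ)..R, iteratedDeriv j (h j) x * ω x) =
      ∑ m : Fin n, ∫ x in (0:ℝ)..R, (a (2 * j + 1) i m t x * iteratedDeriv (j + 1) (u m t) x +
        a (2 * j) i m t x * iteratedDeriv j (u m t) x) * iteratedDeriv j ω x := by
    rw [Finset.mem_range] at hj
    rw [neg_one_pow_mul_integral_iteratedDeriv_mul (hhj j hj) (hωj j hj.le)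
      (fun p hp => hω0 p (by omega)) (fun p hp => hωR p (by omega)),
      ← intervalIntegral.integral_finsetSum fun m _ => ?_]
    · simp only [hh, Finset.sum_mul]
    · have c1 := (hsec (ha (2 * j + 1) (by omega) i m)).continuous
      have c2 := (hsec (ha (2 * j) (by omega) i m)).continuous
      have c3 := (huD m 0 (j + 1)).continuous
      have c4 := (huD m 0 j).continuous
      have c5 := (hωD j hj.le).continuous
      exact (by fun_prop : Continuous _).intervalIntegrable _ _
  have hforce (j : ℕ) (hj : j ∈ Finset.range (l + 1)) :
      (-1 : ℝ) ^ j * (∫ x in (0:ℝ)..R, iteratedDeriv j (G j i t) x * ω x) =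
      ∫ x in (0:ℝ)..R, G j i t x * iteratedDeriv j ω x := by
    have hj := Nat.lt_succ_iff.mp (Finset.mem_range.mp hj)
    exact neg_one_pow_mul_integral_iteratedDeriv_mul ((hsec (hG j hj i)).of_le (hle _))
      (hωj j hj) (fun p hp => hω0 p (by omega)) (fun p hp => hωR p (by omega))
  have hterm (m : Fin n) (j : ℕ) (hj : j < l) :=
    integral_lower_terms_mul (hsec (ha (2 * j + 1) (by omega) i m))
      (hsec (ha (2 * j) (by omega) i m)) (hsec (hu m)) (hωD j hj.le) (hω0 j hj.le) (hωR j hj)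
  have hmid := (Finset.sum_congr rfl hlower).trans <| Finset.sum_comm.trans <|
    Finset.sum_congr rfl fun m _ => Finset.sum_congr rfl fun j hj =>
      hterm m j (Finset.mem_range.mp hj)
  rw [(hasDerivAt_intervalIntegral_mul ((hu i).of_le (hle 1)) cω 0 R t).deriv, hsplit,
    integral_leading_terms_mul (A i) (B i) (hsec (hu i)) hω hω0 hωR, hmid,
    Finset.sum_congr rfl hforce]
  simp only [Finset.sum_add_distrib]
  ring
end

section
/- Let R > 0, let l ≥ 1, j, k, m be integers with 0 ≤ j ≤ l and 0 ≤ k, m ≤ l−1, and let b be a real number with 0 < b ≤ (4l−2j−2k)/(2m+1). For every ε > 0 there exists a constant c(ε) > 0, depending only on R, l, j, k, m, b and ε, such that for all functions u, v : ℝ → ℝ which are l times continuously differentiable on [0,R], ∫₀^R |u^{(m)}(x)|^{b} |v^{(k)}(x)| · |v^{(j)}(x)| dx ≤ ε ∫₀^R (v^{(l)}(x))² dx + c(ε) ( sup_{x ∈ [0,R]} |u^{(m)}(x)|^{2lb/(2l−j−k)} + sup_{x ∈ [0,R]} |u^{(m)}(x)|^{b} ) ∫₀^R v(x)² (1+x)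 dx. -/
open MeasureTheory Set

/-- A one-dimensional interpolation inequality: the `L²` norm of `f'` on `[0, R]` is controlled by
those of `f` and `f''`, with weights that scale. -/
lemma integral_deriv_sq_le {R : ℝ} (hR : 0 < R) {f g h : ℝ → ℝ}
    (hf : ContinuousOn f (Icc 0 R)) (hg : ContinuousOn g (Icc 0 R))
    (hh : ContinuousOn h (Icc 0 R))
    (hfg : ∀ x ∈ Ioo 0 R, HasDerivAt f (g x) x) (hgh : ∀ x ∈ Ioo 0 R, HasDerivAt g (h x) x)
    {r : ℝ} (hr : 0 < r) (hrR : r ≤ R / 4) :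
    ∫ x in (0:ℝ)..R, g x ^ 2 ≤
      6 * (r ^ 2 * (∫ x in (0:ℝ)..R, h x ^ 2) + (∫ x in (0:ℝ)..R, f x ^ 2) / r ^ 2) := by
  have hu : uIcc 0 R = Icc 0 R := uIcc_of_le hR.le
  set G : ℝ → ℝ := fun x => f x * g x - r / 2 * ((2 / R * x - 1) * g x ^ 2)
    - 1 / (2 * r) * ((2 / R * x - 1) * f x ^ 2) with hG
  set G' : ℝ → ℝ := fun x => (g x * g x + f x * h x)
    - r / 2 * (2 / R * g x ^ 2 + (2 / R * x - 1) * (2 * g x * h x))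
    - 1 / (2 * r) * (2 / R * f x ^ 2 + (2 / R * x - 1) * (2 * f x * g x)) with hG'
  have hGc : ContinuousOn G (Icc 0 R) := by fun_prop
  have hG'c : ContinuousOn G' (Icc 0 R) := by fun_prop
  have hGd : ∀ x ∈ Ioo 0 R, HasDerivAt G (G' x) x := by
    intro x hx
    have h1 : HasDerivAt (fun x : ℝ => 2 / R * x - 1) (2 / R) x := by
      simpa using ((hasDerivAt_id x).const_mul (2 / R)).sub_const 1
    have h2 := ((hfg x hx).mul (hgh x hx)).sub ((h1.mul ((hgh x hx).pow 2)).const_mul (r / 2))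
    have h3 := h2.sub ((h1.mul ((hfg x hx).pow 2)).const_mul (1 / (2 * r)))
    refine h3.congr_deriv ?_
    simp only [hG', Pi.pow_apply]
    push_cast
    ring
  have hG'i : IntervalIntegrable G' volume 0 R := ContinuousOn.intervalIntegrable (by rwa [hu])
  have hftc := intervalIntegral.integral_eq_sub_of_hasDerivAt_of_le hR.le hGc hGd hG'i
  have hbd : G R - G 0 ≤ 0 := by
    have e1 : G R = -(1 / (2 * r)) * (r * g R - f R) ^ 2 := by
      simp only [hG]; field_simp; ring
    have e2 : G 0 = (1 / (2 * r)) * (r * g 0 + f 0) ^ 2 := by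
      simp only [hG]; field_simp; ring
    rw [e1, e2]
    have : 0 ≤ (1 / (2 * r)) * (r * g R - f R) ^ 2 := by positivity
    have : 0 ≤ (1 / (2 * r)) * (r * g 0 + f 0) ^ 2 := by positivity
    linarith
  have hpt : ∀ x ∈ Icc 0 R,
      1 / 2 * g x ^ 2 - (5 / 2 * r ^ 2) * h x ^ 2 - (11 / 4 / r ^ 2) * f x ^ 2 ≤ G' x := by
    intro x hx
    obtain ⟨y, hy⟩ : ∃ y, f x = r * y := ⟨f x / r, by field_simp⟩
    set d := r / R with hd
    have hd1 : d ≤ 1 / 4 := by rw [hd, div_le_iff₀ hR]; linarith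
    set φ := 2 / R * x - 1 with hφx
    have hxR0 : 0 ≤ x / R := div_nonneg hx.1 hR.le
    have hxR1 : x / R ≤ 1 := by rw [div_le_one hR]; exact hx.2
    have hφe : φ = 2 * (x / R) - 1 := by rw [hφx]; ring
    have hφ2 : φ ^ 2 ≤ 1 := by rw [hφe]; nlinarith
    have e1 : G' x = g x ^ 2 + y * (r * h x) - d * g x ^ 2 - φ * g x * (r * h x) - d * y ^ 2
        - φ * y * g x := by
      simp only [hG', hy, ← hφx, hd]; field_simp; ring
    have e2 : (11 / 4 / r ^ 2) * f x ^ 2 = 11 / 4 * y ^ 2 := by rw [hy]; field_simp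
    rw [e1, e2]
    set z := r * h x
    have e3 : (5 / 2 * r ^ 2) * h x ^ 2 = 5 / 2 * z ^ 2 := by simp only [z]; ring
    rw [e3]
    have a1 := sq_nonneg (g x - 4 * φ * z)
    have a2 := sq_nonneg (g x - 4 * φ * y)
    have a3 := mul_le_mul_of_nonneg_right hφ2 (sq_nonneg z)
    have a4 := mul_le_mul_of_nonneg_right hφ2 (sq_nonneg y)
    have a5 := mul_le_mul_of_nonneg_right hd1 (sq_nonneg y)
    have a6 := mul_le_mul_of_nonneg_right hd1 (sq_nonneg (g x))
    have a7 := sq_nonneg (y + z)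
    nlinarith
  have sqi : ∀ {w : ℝ → ℝ}, ContinuousOn w (Icc 0 R) →
      ∀ c : ℝ, IntervalIntegrable (fun x => c * w x ^ 2) volume 0 R := fun {w} hw c =>
    ContinuousOn.intervalIntegrable (by rw [hu]; fun_prop)
  have key := intervalIntegral.integral_mono_on hR.le
    (((sqi hg (1 / 2)).sub (sqi hh (5 / 2 * r ^ 2))).sub (sqi hf (11 / 4 / r ^ 2))) hG'i hpt
  rw [intervalIntegral.integral_sub ((sqi hg _).sub (sqi hh _)) (sqi hf _),
    intervalIntegral.integral_sub (sqi hg _) (sqi hh _)] at key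
  simp only [intervalIntegral.integral_const_mul] at key
  have hh0 : 0 ≤ r ^ 2 * ∫ x in (0:ℝ)..R, h x ^ 2 :=
    mul_nonneg (by positivity) (intervalIntegral.integral_nonneg hR.le fun _ _ => sq_nonneg _)
  have hf0 : 0 ≤ (∫ x in (0:ℝ)..R, f x ^ 2) / r ^ 2 :=
    div_nonneg (intervalIntegral.integral_nonneg hR.le fun _ _ => sq_nonneg _) (by positivity)
  have e4 : 11 / 4 / r ^ 2 * (∫ x in (0:ℝ)..R, f x ^ 2) =
      11 / 4 * ((∫ x in (0:ℝ)..R, f x ^ 2) / r ^ 2) := by ring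
  rw [e4] at key
  linarith

/-- Local interpolation between neighbours iterates to interpolation between `a 0` and
`a (n + 1)`. -/
lemma exists_interpolation_succ (n : ℕ) : ∃ C : ℝ, 1 ≤ C ∧ ∀ (T : ℝ) (a : ℕ → ℝ),
    (∀ i, 0 ≤ a i) →
    (∀ t, 0 < t → t ≤ T → ∀ i < n, a (i + 1) ≤ 6 * (t * a (i + 2) + a i / t)) →
    ∀ t, 0 < t → t ≤ T → a n ≤ C * (t * a (n + 1) + a 0 / t ^ n) := by
  induction n with
  | zero =>
    refine ⟨1, le_rfl, fun T a ha _ t ht _ => ?_⟩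
    have := mul_nonneg ht.le (ha 1)
    simpa using this
  | succ n ih =>
    obtain ⟨C, hC, ih⟩ := ih
    refine ⟨12 * C * (12 * C) ^ n, ?_, fun T a ha h t ht htT => ?_⟩
    · have : 1 ≤ (12 * C) ^ n := one_le_pow₀ (by linarith)
      nlinarith
    have hC0 : 0 < C := by linarith
    have h1 := h t ht htT n n.lt_succ_self
    have hs : t / (12 * C) ≤ t := div_le_self ht.le (by linarith)
    have h2 := ih T a ha (fun t ht htT i hi => h t ht htT i (by omega)) (t / (12 * C))
      (by positivity) (hs.trans htT)
    have h3 : 6 * (a n / t) ≤ a (n + 1) / 2 + 6 * C * (12 * C) ^ n * (a 0 / t ^ (n + 1)) := by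
      have : 6 * (a n / t) ≤
          6 * ((C * (t / (12 * C) * a (n + 1) + a 0 / (t / (12 * C)) ^ n)) / t) := by gcongr
      refine this.trans (le_of_eq ?_)
      rw [div_pow]
      field_simp
      ring
    have h4 : 0 ≤ t * a (n + 2) := mul_nonneg ht.le (ha _)
    have h5 : 1 ≤ C * (12 * C) ^ n := one_le_mul_of_one_le_of_one_le hC
      (one_le_pow₀ (by linarith))
    have h6 := mul_le_mul_of_nonneg_right h5 h4
    have : a (n + 1) ≤ 12 * (t * a (n + 2)) + 12 * C * (12 * C) ^ n * (a 0 / t ^ (n + 1)) := by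
      linarith
    linarith

lemma exists_interpolation {k l : ℕ} (hkl : k ≤ l) : ∃ C : ℝ, 1 ≤ C ∧ ∀ (T : ℝ) (a : ℕ → ℝ),
    (∀ i, 0 ≤ a i) →
    (∀ t, 0 < t → t ≤ T → ∀ i, i + 2 ≤ l → a (i + 1) ≤ 6 * (t * a (i + 2) + a i / t)) →
    ∀ t, 0 < t → t ≤ T → t ^ k * a k ≤ C * (t ^ l * a l + a 0) := by
  induction l, hkl using Nat.le_induction with
  | base =>
    exact ⟨1, le_rfl, fun T a ha _ t _ _ => by linarith [ha 0]⟩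
  | succ n hkn ih =>
    obtain ⟨C, hC, ih⟩ := ih
    obtain ⟨D, hD, hDa⟩ := exists_interpolation_succ n
    refine ⟨2 * C * D, by nlinarith, fun T a ha h t ht htT => ?_⟩
    have h1 := ih T a ha (fun t ht htT i hi => h t ht htT i (by omega)) t ht htT
    have h2 := hDa T a ha (fun t ht htT i hi => h t ht htT i (by omega)) t ht htT
    have h3 : t ^ n * a n ≤ D * (t ^ (n + 1) * a (n + 1) + a 0) := by
      refine (mul_le_mul_of_nonneg_left h2 (by positivity)).trans (le_of_eq ?_)
      field_simp
      ring
    have h4 : a 0 ≤ D * (t ^ (n + 1) * a (n + 1) + a 0) := by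
      have := mul_nonneg (pow_nonneg ht.le (n + 1)) (ha (n + 1))
      nlinarith [ha 0]
    calc t ^ k * a k ≤ C * (t ^ n * a n + a 0) := h1
      _ ≤ C * (D * (t ^ (n + 1) * a (n + 1) + a 0) + D * (t ^ (n + 1) * a (n + 1) + a 0)) := by
        gcongr
      _ = _ := by ring

lemma hasDerivAt_iteratedDerivWithin_Icc {R : ℝ} (hR : 0 < R) {l i : ℕ} (hi : i < l) {v : ℝ → ℝ}
    (hv : ContDiffOn ℝ l v (Icc 0 R)) {x : ℝ} (hx : x ∈ Ioo 0 R) :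
    HasDerivAt (iteratedDerivWithin i v (Icc 0 R)) (iteratedDerivWithin (i + 1) v (Icc 0 R) x)
      x := by
  have h := hv.differentiableOn_iteratedDerivWithin (by exact_mod_cast hi) (uniqueDiffOn_Icc hR)
    x (Ioo_subset_Icc_self hx)
  rw [iteratedDerivWithin_succ]
  exact h.hasDerivWithinAt.hasDerivAt (Icc_mem_nhds hx.1 hx.2)

lemma exists_integral_abs_mul_iteratedDerivWithin_le {R : ℝ} (hR : 0 < R) {l j k : ℕ}
    (hj : j ≤ l) (hk : k ≤ l) : ∃ C : ℝ, 1 ≤ C ∧ ∀ v : ℝ → ℝ, ContDiffOn ℝ l v (Icc 0 R) →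
      ∀ r, 0 < r → r ≤ R / 4 →
        r ^ (j + k) * (∫ x in (0:ℝ)..R,
          |iteratedDerivWithin k v (Icc 0 R) x| * |iteratedDerivWithin j v (Icc 0 R) x|) ≤
        C * (r ^ (2 * l) * (∫ x in (0:ℝ)..R, (iteratedDerivWithin l v (Icc 0 R) x) ^ 2) +
          ∫ x in (0:ℝ)..R, v x ^ 2) := by
  obtain ⟨C, hC, hCa⟩ := exists_interpolation hj
  obtain ⟨D, hD, hDa⟩ := exists_interpolation hk
  refine ⟨C + D, by linarith, fun v hv r hr hrR => ?_⟩
  have hc : ∀ i ≤ l, ContinuousOn (iteratedDerivWithin i v (Icc 0 R)) (Icc 0 R) := fun i hi =>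
    hv.continuousOn_iteratedDerivWithin (by exact_mod_cast hi) (uniqueDiffOn_Icc hR)
  set a : ℕ → ℝ := fun i => ∫ x in (0:ℝ)..R, (iteratedDerivWithin i v (Icc 0 R) x) ^ 2 with ha
  have ha0 : ∀ i, 0 ≤ a i := fun i =>
    intervalIntegral.integral_nonneg hR.le fun _ _ => sq_nonneg _
  have hint : ∀ t, 0 < t → t ≤ (R / 4) ^ 2 → ∀ i, i + 2 ≤ l →
      a (i + 1) ≤ 6 * (t * a (i + 2) + a i / t) := by
    intro t ht htR i hi
    have := integral_deriv_sq_le hR (hc i (by omega)) (hc (i + 1) (by omega)) (hc (i + 2) hi)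
      (fun x hx => hasDerivAt_iteratedDerivWithin_Icc hR (by omega) hv hx)
      (fun x hx => hasDerivAt_iteratedDerivWithin_Icc hR (by omega) hv hx)
      (Real.sqrt_pos.2 ht) (Real.sqrt_le_iff.2 ⟨by positivity, htR⟩)
    rwa [Real.sq_sqrt ht.le] at this
  have hrt : r ^ 2 ≤ (R / 4) ^ 2 := by gcongr
  have h1 := hCa _ a ha0 hint (r ^ 2) (by positivity) hrt
  have h2 := hDa _ a ha0 hint (r ^ 2) (by positivity) hrt
  have hu : uIcc 0 R = Icc 0 R := uIcc_of_le hR.le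
  have hcj := hc j hj
  have hck := hc k hk
  have h3 : r ^ (j + k) * (∫ x in (0:ℝ)..R,
      |iteratedDerivWithin k v (Icc 0 R) x| * |iteratedDerivWithin j v (Icc 0 R) x|) ≤
      (r ^ 2) ^ j * a j + (r ^ 2) ^ k * a k := by
    simp only [ha, ← intervalIntegral.integral_const_mul]
    rw [← intervalIntegral.integral_add
      (ContinuousOn.intervalIntegrable (by rw [hu]; fun_prop))
      (ContinuousOn.intervalIntegrable (by rw [hu]; fun_prop))]
    refine intervalIntegral.integral_mono_on hR.le
      (ContinuousOn.intervalIntegrable (by rw [hu]; fun_prop))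
      (ContinuousOn.intervalIntegrable (by rw [hu]; fun_prop)) fun x _ => ?_
    rw [← sq_abs (iteratedDerivWithin k v (Icc 0 R) x),
      ← sq_abs (iteratedDerivWithin j v (Icc 0 R) x), pow_add, ← pow_mul, ← pow_mul,
      mul_comm 2 j, mul_comm 2 k, pow_mul, pow_mul]
    set p := |iteratedDerivWithin k v (Icc 0 R) x|
    set q := |iteratedDerivWithin j v (Icc 0 R) x|
    nlinarith [sq_nonneg (r ^ j * q - r ^ k * p), sq_nonneg (r ^ j * q + r ^ k * p)]
  have e0 : a 0 = ∫ x in (0:ℝ)..R, v x ^ 2 := by simp [ha]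
  rw [← e0]
  have e1 : (r ^ 2) ^ l = r ^ (2 * l) := (pow_mul r 2 l).symm
  rw [e1] at h1 h2
  linarith

/-- Optimising a family of bounds `r ^ s * I ≤ C * (r ^ (p + s) * X + Y)` over `r ∈ (0, r₀]`. -/
lemma exists_mul_le_of_forall_scale {r₀ C ε : ℝ} (hr₀ : 0 < r₀) (hC : 0 < C) (hε : 0 < ε)
    {p s : ℕ} (hp : 0 < p) : ∃ c : ℝ, 0 < c ∧ ∀ A I X Y : ℝ, 0 ≤ A → 0 ≤ X → 0 ≤ Y →
      (∀ r, 0 < r → r ≤ r₀ → r ^ s * I ≤ C * (r ^ (p + s) * X + Y)) →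
      A * I ≤ ε * X + c * (A ^ ((p + s : ℝ) / p) + A) * Y := by
  refine ⟨C / r₀ ^ s + C * (C / ε) ^ ((s : ℝ) / p), by positivity,
    fun A I X Y hA hX hY h => ?_⟩
  have hp' : (p : ℝ) ≠ 0 := by positivity
  have hI : ∀ r, 0 < r → r ≤ r₀ → A * I ≤ A * C * r ^ p * X + A * (C / r ^ s) * Y := by
    intro r hr hr'
    have h1 : I ≤ C * r ^ p * X + C / r ^ s * Y := by
      have := h r hr hr'
      rw [← le_div_iff₀' (by positivity)] at this
      refine this.trans (le_of_eq ?_)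
      rw [pow_add]; field_simp
    refine (mul_le_mul_of_nonneg_left h1 hA).trans (le_of_eq (by ring))
  have hA1 : 0 ≤ A ^ ((p + s : ℝ) / p) := Real.rpow_nonneg hA _
  have hc1 : 0 ≤ C / r₀ ^ s := by positivity
  have hc2 : 0 ≤ C * (C / ε) ^ ((s : ℝ) / p) := by positivity
  rcases le_or_gt (A * C * r₀ ^ p) ε with hle | hgt
  · have hle' := mul_le_mul_of_nonneg_right hle hX
    refine (hI r₀ hr₀ le_rfl).trans ?_
    refine add_le_add hle' (mul_le_mul_of_nonneg_right ?_ hY)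
    nlinarith [mul_nonneg hc1 hA1, mul_nonneg hc2 hA1, mul_nonneg hc2 hA]
  · have hA' : 0 < A := by
      rcases hA.eq_or_lt with h0 | h0
      · rw [← h0] at hgt; simp at hgt; linarith
      · exact h0
    set r := (ε / (A * C)) ^ (1 / (p : ℝ)) with hr
    have hr0 : 0 < r := by positivity
    have hrp : r ^ p = ε / (A * C) := by
      rw [hr, ← Real.rpow_mul_natCast (by positivity), one_div_mul_cancel hp', Real.rpow_one]
    have hrr : r ≤ r₀ := by
      refine le_of_lt (lt_of_pow_lt_pow_left₀ p hr₀.le ?_)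
      rw [hrp, div_lt_iff₀ (by positivity)]
      linarith
    have hrs : A / r ^ s = (C / ε) ^ ((s : ℝ) / p) * A ^ ((p + s : ℝ) / p) := by
      have e1 : r ^ s = (ε / (A * C)) ^ ((s : ℝ) / p) := by
        rw [hr, ← Real.rpow_mul_natCast (by positivity)]; congr 1; ring
      have e2 : (p + s : ℝ) / p = 1 + (s : ℝ) / p := by field_simp
      rw [e1, e2, Real.rpow_add hA', Real.rpow_one, div_eq_mul_inv,
        ← Real.inv_rpow (by positivity), inv_div, mul_div_assoc,
        Real.mul_rpow hA (by positivity)]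
      ring
    have h1 : A * (C / r ^ s) = C * (C / ε) ^ ((s : ℝ) / p) * A ^ ((p + s : ℝ) / p) := by
      rw [mul_assoc, ← hrs]; ring
    have h2 : A * C * r ^ p = ε := by rw [hrp]; field_simp
    have h3 := hI r hr0 hrr
    rw [h1, h2] at h3
    refine h3.trans ?_
    refine add_le_add le_rfl (mul_le_mul_of_nonneg_right ?_ hY)
    nlinarith [mul_nonneg hc1 hA1, mul_nonneg hc1 hA, mul_nonneg hc2 hA]

lemma IsMaxOn.le_biSup_rpow {f : ℝ → ℝ} {s : Set ℝ} {x₀ e : ℝ} (hx₀ : x₀ ∈ s)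
    (h : IsMaxOn (fun x => |f x|) s x₀) (he : 0 ≤ e) :
    |f x₀| ^ e ≤ ⨆ x ∈ s, |f x| ^ e := by
  have hb : BddAbove (range fun x => ⨆ _ : x ∈ s, |f x| ^ e) := by
    refine ⟨|f x₀| ^ e, ?_⟩
    rintro _ ⟨x, rfl⟩
    refine Real.iSup_le (fun hx => ?_) (by positivity)
    exact Real.rpow_le_rpow (abs_nonneg _) (h hx) he
  refine le_trans (le_of_eq ?_) (le_ciSup hb x₀)
  simp [hx₀]

/-- Estimate (3.24) of the paper; the constant `c(ε)` depends only on
`R, l, j, k, m, b` and `ε`. -/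
theorem estimate_3_24 (R : ℝ) (hR : 0 < R) (l j k m : ℕ) (hl : 1 ≤ l) (hj : j ≤ l)
    (hk : k < l) (hm : m < l) (b : ℝ) (hb0 : 0 < b)
    (hb : b ≤ (4 * (l : ℝ) - 2 * (j : ℝ) - 2 * (k : ℝ)) / (2 * (m : ℝ) + 1)) :
    ∀ ε : ℝ, 0 < ε → ∃ c : ℝ, 0 < c ∧
      ∀ u v : ℝ → ℝ, ContDiffOn ℝ l u (Icc 0 R) → ContDiffOn ℝ l v (Icc 0 R) →
        (∫ x in (0:ℝ)..R, |iteratedDerivWithin m u (Icc 0 R) x| ^ b *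
            |iteratedDerivWithin k v (Icc 0 R) x| * |iteratedDerivWithin j v (Icc 0 R) x|) ≤
          ε * (∫ x in (0:ℝ)..R, (iteratedDerivWithin l v (Icc 0 R) x) ^ 2) +
            c * ((⨆ x ∈ Icc (0:ℝ) R, |iteratedDerivWithin m u (Icc 0 R) x| ^
                    ((2 * (l : ℝ) * b) / (2 * (l : ℝ) - (j : ℝ) - (k : ℝ)))) +
                 (⨆ x ∈ Icc (0:ℝ) R, |iteratedDerivWithin m u (Icc 0 R) x| ^ b)) *
              ∫ x in (0:ℝ)..R, (v x) ^ 2 * (1 + x) := by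
  intro ε hε
  obtain ⟨C, hC, hCv⟩ := exists_integral_abs_mul_iteratedDerivWithin_le hR hj hk.le
  obtain ⟨p, hp⟩ : ∃ p, 2 * l = p + (j + k) := ⟨2 * l - (j + k), by omega⟩
  have hp0 : 0 < p := by omega
  obtain ⟨c, hc, hcA⟩ := exists_mul_le_of_forall_scale (r₀ := R / 4) (C := C) (by positivity)
    (by linarith) hε (s := j + k) hp0
  refine ⟨c, hc, fun u v hu hv => ?_⟩
  have huI : uIcc 0 R = Icc 0 R := uIcc_of_le hR.le
  have hcont : ∀ {w : ℝ → ℝ}, ContDiffOn ℝ l w (Icc 0 R) → ∀ i ≤ l,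
      ContinuousOn (iteratedDerivWithin i w (Icc 0 R)) (Icc 0 R) := fun hw i hi =>
    hw.continuousOn_iteratedDerivWithin (by exact_mod_cast hi) (uniqueDiffOn_Icc hR)
  have hum := hcont hu m hm.le
  have hvk := hcont hv k hk.le
  have hvj := hcont hv j hj
  have hv0 : ContinuousOn v (Icc 0 R) := hv.continuousOn
  obtain ⟨x₀, hx₀, hmax⟩ := isCompact_Icc.exists_isMaxOn (nonempty_Icc.2 hR.le) hum.abs
  have hpR : (2 * l : ℝ) = p + (j + k) := by exact_mod_cast hp
  have hpe : (2 * (l : ℝ) * b) / (2 * (l : ℝ) - (j : ℝ) - (k : ℝ)) =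
      b * (((p : ℝ) + ((j + k : ℕ) : ℝ)) / p) := by
    have : (2 * (l : ℝ) - (j : ℝ) - (k : ℝ)) = p := by linarith
    rw [this, hpR]; push_cast; ring
  have hs1 := hmax.le_biSup_rpow hx₀ hb0.le
  have hs2 := hmax.le_biSup_rpow hx₀
    (e := (2 * (l : ℝ) * b) / (2 * (l : ℝ) - (j : ℝ) - (k : ℝ))) (by rw [hpe]; positivity)
  have hub : ContinuousOn (fun x => |iteratedDerivWithin m u (Icc 0 R) x| ^ b) (Icc 0 R) :=
    hum.abs.rpow_const fun _ _ => Or.inr hb0.le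
  have hY : ∫ x in (0:ℝ)..R, v x ^ 2 ≤ ∫ x in (0:ℝ)..R, v x ^ 2 * (1 + x) := by
    refine intervalIntegral.integral_mono_on hR.le
      (ContinuousOn.intervalIntegrable (by rw [huI]; fun_prop))
      (ContinuousOn.intervalIntegrable (by rw [huI]; fun_prop)) fun x hx => ?_
    nlinarith [mul_nonneg (sq_nonneg (v x)) hx.1]
  have hY0 : 0 ≤ ∫ x in (0:ℝ)..R, v x ^ 2 :=
    intervalIntegral.integral_nonneg hR.le fun _ _ => sq_nonneg _
  set A := |iteratedDerivWithin m u (Icc 0 R) x₀| ^ b with hA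
  have hA0 : 0 ≤ A := by positivity
  have hstep : (∫ x in (0:ℝ)..R, |iteratedDerivWithin m u (Icc 0 R) x| ^ b *
      |iteratedDerivWithin k v (Icc 0 R) x| * |iteratedDerivWithin j v (Icc 0 R) x|) ≤
      A * ∫ x in (0:ℝ)..R,
        |iteratedDerivWithin k v (Icc 0 R) x| * |iteratedDerivWithin j v (Icc 0 R) x| := by
    rw [← intervalIntegral.integral_const_mul]
    refine intervalIntegral.integral_mono_on hR.le
      (ContinuousOn.intervalIntegrable (by rw [huI]; fun_prop))
      (ContinuousOn.intervalIntegrable (by rw [huI]; fun_prop)) fun x hx => ?_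
    rw [mul_assoc]
    gcongr
    exact Real.rpow_le_rpow (abs_nonneg _) (hmax hx) hb0.le
  have hfin := hcA A _ _ _ hA0 (intervalIntegral.integral_nonneg hR.le fun _ _ => sq_nonneg _)
    hY0 (fun r hr hrR => hp ▸ hCv v hv r hr hrR)
  refine hstep.trans (hfin.trans ?_)
  rw [hA, ← Real.rpow_mul (abs_nonneg _), ← hpe]
  have hs0 : 0 ≤ |iteratedDerivWithin m u (Icc 0 R) x₀| ^
      ((2 * (l : ℝ) * b) / (2 * (l : ℝ) - (j : ℝ) - (k : ℝ))) := by positivity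
  gcongr
  exact mul_nonneg hc.le (add_nonneg (hs0.trans hs2) (hA0.trans hs1))
end

section
/- Let R > 0, let l ≥ 1, j, k, m be integers with 0 ≤ j, k, m ≤ l−1, and let b', b'' be real numbers with 0 ≤ b' ≤ (2l−2j)/(2m+1) and 0 ≤ b'' ≤ (2l−2k)/(2m+1). For every ε > 0 there exists a constant c(ε) > 0, depending only on R, l, j, k, m, b', b'' and ε, such that for all functions u, v, w : ℝ → ℝ which are l times continuously differentiable on [0,R], ∫₀^R |u^{(m)}(x)|^{b'+b''} |w^{(k)}(x)| · |v^{(j)}(x)| dx ≤ ε ∫₀^R (v^{(l)})² dx + c(ε) ( sup_{[0,R]} |u^{(m)}|^{2lb'/(l−j)} + sup_{[0,R]} |u^{(m)}|^{2b'} ) ∫₀^R v²(1+x) dx + c(ε) ∫₀^R (w^{(l)})² dx + c(ε) ( sup_{[0,R]} |u^{(m)}|^{2lb''/(l−k)} + sup_{[0,R]} |u^{(m)}|^{2b''} ) ∫₀^R w² dx. -/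
open MeasureTheory Set

/-- Trace inequality on an interval: the value of `g` at any point is controlled by the `L²` norms
of `g` and of its derivative. -/
lemma sq_le_integral_sq_add_integral_deriv_sq {R : ℝ} (hR : 0 < R) {g g' : ℝ → ℝ}
    (hg' : ContinuousOn g' (Icc 0 R))
    (hd : ∀ x ∈ Icc 0 R, HasDerivWithinAt g (g' x) (Icc 0 R) x)
    {r : ℝ} (hr : 0 < r) {x : ℝ} (hx : x ∈ Icc 0 R) :
    g x ^ 2 ≤ (1 / R + 1 / r) * (∫ t in (0 : ℝ)..R, g t ^ 2) +
      r * ∫ t in (0 : ℝ)..R, g' t ^ 2 := by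
  have hg : ContinuousOn g (Icc 0 R) := fun y hy => (hd y hy).continuousWithinAt
  have hu : uIcc 0 R = Icc 0 R := uIcc_of_le hR.le
  have hI : IntervalIntegrable (fun t => g t ^ 2) volume 0 R :=
    (hu ▸ hg.pow 2 : ContinuousOn _ (uIcc 0 R)).intervalIntegrable
  have hI' : IntervalIntegrable (fun t => g' t ^ 2) volume 0 R :=
    (hu ▸ hg'.pow 2 : ContinuousOn _ (uIcc 0 R)).intervalIntegrable
  set D : ℝ → ℝ := fun t => 1 / r * g t ^ 2 + r * g' t ^ 2 with hD
  have hDI : IntervalIntegrable D volume 0 R := (hI.const_mul _).add (hI'.const_mul _)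
  have hDint : ∫ t in (0 : ℝ)..R, D t =
      1 / r * (∫ t in (0 : ℝ)..R, g t ^ 2) + r * ∫ t in (0 : ℝ)..R, g' t ^ 2 := by
    rw [hD, intervalIntegral.integral_add (hI.const_mul _) (hI'.const_mul _),
      intervalIntegral.integral_const_mul, intervalIntegral.integral_const_mul]
  have hD0 : ∀ t, 0 ≤ D t := fun t => by positivity
  have hbound : ∀ t, |2 * g t * g' t| ≤ D t := by
    intro t
    have h1 : D t - 2 * g t * g' t = (g t - r * g' t) ^ 2 / r := by
      simp only [hD]; field_simp; ring
    have h2 : D t + 2 * g t * g' t = (g t + r * g' t) ^ 2 / r := by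
      simp only [hD]; field_simp; ring
    have h3 : 0 ≤ (g t - r * g' t) ^ 2 / r := by positivity
    have h4 : 0 ≤ (g t + r * g' t) ^ 2 / r := by positivity
    rw [abs_le]
    constructor <;> linarith
  have key : ∀ a ∈ Icc 0 R, ∀ b ∈ Icc 0 R, a ≤ b →
      |g b ^ 2 - g a ^ 2| ≤ ∫ t in (0 : ℝ)..R, D t := by
    intro a ha b hb hab
    have hsub : Icc a b ⊆ Icc 0 R := Icc_subset_Icc ha.1 hb.2
    have hcd : ContinuousOn (fun t => 2 * g t * g' t) (Icc a b) :=
      ((continuousOn_const.mul hg).mul hg').mono hsub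
    have hii : IntervalIntegrable (fun t => 2 * g t * g' t) volume a b :=
      (uIcc_of_le hab ▸ hcd : ContinuousOn _ (uIcc a b)).intervalIntegrable
    have hftc : ∫ t in a..b, 2 * g t * g' t = g b ^ 2 - g a ^ 2 := by
      refine intervalIntegral.integral_eq_sub_of_hasDerivAt_of_le hab ((hg.pow 2).mono hsub)
        (fun t ht => ?_) hii
      have ht' : t ∈ Icc 0 R := hsub (Ioo_subset_Icc_self ht)
      have hgt := (hd t ht').hasDerivAt
        (Icc_mem_nhds (ha.1.trans_lt ht.1) (ht.2.trans_le hb.2))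
      exact (hgt.pow 2).congr_deriv (by norm_num)
    have hDab : IntervalIntegrable D volume a b := hDI.mono_set (by
      rw [uIcc_of_le hab, hu]; exact hsub)
    rw [← hftc]
    calc |∫ t in a..b, 2 * g t * g' t| ≤ ∫ t in a..b, |2 * g t * g' t| :=
          intervalIntegral.abs_integral_le_integral_abs hab
      _ ≤ ∫ t in a..b, D t :=
          intervalIntegral.integral_mono_on hab hii.abs hDab fun t _ => hbound t
      _ ≤ ∫ t in (0 : ℝ)..R, D t :=
          intervalIntegral.integral_mono_interval ha.1 hab hb.2
            (Filter.Eventually.of_forall hD0) hDI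
  have hpt : ∀ y ∈ Icc 0 R, g x ^ 2 ≤ g y ^ 2 + ∫ t in (0 : ℝ)..R, D t := by
    intro y hy
    rcases le_total x y with h | h
    · linarith [(abs_le.1 (key x hx y hy h)).1]
    · linarith [(abs_le.1 (key y hy x hx h)).2]
  have hav : ∫ _ in (0 : ℝ)..R, g x ^ 2 ≤
      ∫ y in (0 : ℝ)..R, (g y ^ 2 + ∫ t in (0 : ℝ)..R, D t) :=
    intervalIntegral.integral_mono_on hR.le (by simp) (hI.add (by simp)) hpt
  rw [intervalIntegral.integral_add hI (by simp), intervalIntegral.integral_const,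
    intervalIntegral.integral_const, hDint, smul_eq_mul, smul_eq_mul, sub_zero] at hav
  rw [← mul_le_mul_iff_right₀ hR]
  refine hav.trans (le_of_eq ?_)
  field_simp
  ring

/-- Interpolation of the `L²` norm of a first derivative at scale `h`. -/
lemma integral_deriv_sq_le_s14 {R : ℝ} {f f' f'' : ℝ → ℝ}
    (hf'' : ContinuousOn f'' (Icc 0 R))
    (hd : ∀ x ∈ Icc 0 R, HasDerivWithinAt f (f' x) (Icc 0 R) x)
    (hd' : ∀ x ∈ Icc 0 R, HasDerivWithinAt f' (f'' x) (Icc 0 R) x)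
    {h : ℝ} (hh : 0 < h) (hhR : h ≤ R) :
    ∫ t in (0 : ℝ)..R, f' t ^ 2 ≤
      1000 * (h ^ 2 * (∫ t in (0 : ℝ)..R, f'' t ^ 2) + (∫ t in (0 : ℝ)..R, f t ^ 2) / h ^ 2) := by
  have hR : 0 < R := hh.trans_le hhR
  have hf : ContinuousOn f (Icc 0 R) := fun y hy => (hd y hy).continuousWithinAt
  have hf' : ContinuousOn f' (Icc 0 R) := fun y hy => (hd' y hy).continuousWithinAt
  have hii : ∀ {g : ℝ → ℝ}, ContinuousOn g (Icc 0 R) → IntervalIntegrable g volume 0 R :=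
    fun {g} hg => (uIcc_of_le hR.le ▸ hg : ContinuousOn g (uIcc 0 R)).intervalIntegrable
  have hsq : ∀ {g : ℝ → ℝ}, ContinuousOn g (Icc 0 R) →
      IntervalIntegrable (fun t => g t ^ 2) volume 0 R := fun hg => hii (hg.pow 2)
  have hff'' : IntervalIntegrable (fun t => f t * f'' t) volume 0 R := hii (hf.mul hf'')
  have ha0 : 0 ≤ ∫ t in (0 : ℝ)..R, f t ^ 2 :=
    intervalIntegral.integral_nonneg hR.le fun t _ => sq_nonneg _
  have hb0 : 0 ≤ ∫ t in (0 : ℝ)..R, f' t ^ 2 :=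
    intervalIntegral.integral_nonneg hR.le fun t _ => sq_nonneg _
  have hc0 : 0 ≤ ∫ t in (0 : ℝ)..R, f'' t ^ 2 :=
    intervalIntegral.integral_nonneg hR.le fun t _ => sq_nonneg _
  have hparts : (∫ t in (0 : ℝ)..R, f' t ^ 2) + (∫ t in (0 : ℝ)..R, f t * f'' t) =
      f R * f' R - f 0 * f' 0 := by
    rw [← intervalIntegral.integral_add (hsq hf') hff'']
    refine intervalIntegral.integral_eq_sub_of_hasDerivAt_of_le (f := fun t => f t * f' t) hR.le
      (hf.mul hf') (fun t ht => ?_) ((hsq hf').add hff'')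
    have hn : Icc 0 R ∈ nhds t := Icc_mem_nhds ht.1 ht.2
    have ht' := Ioo_subset_Icc_self ht
    exact (((hd t ht').hasDerivAt hn).mul ((hd' t ht').hasDerivAt hn)).congr_deriv (by ring)
  have hcross : -(∫ t in (0 : ℝ)..R, f t * f'' t) ≤
      1 / (2 * h ^ 2) * (∫ t in (0 : ℝ)..R, f t ^ 2) +
        h ^ 2 / 2 * ∫ t in (0 : ℝ)..R, f'' t ^ 2 := by
    rw [← intervalIntegral.integral_neg, ← intervalIntegral.integral_const_mul,
      ← intervalIntegral.integral_const_mul, ← intervalIntegral.integral_add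
        ((hsq hf).const_mul _) ((hsq hf'').const_mul _)]
    refine intervalIntegral.integral_mono_on hR.le hff''.neg
      (((hsq hf).const_mul _).add ((hsq hf'').const_mul _)) fun t _ => ?_
    have h1 : 1 / (2 * h ^ 2) * f t ^ 2 + h ^ 2 / 2 * f'' t ^ 2 - -(f t * f'' t) =
        (f t + h ^ 2 * f'' t) ^ 2 / (2 * h ^ 2) := by
      field_simp; ring
    have h2 : 0 ≤ (f t + h ^ 2 * f'' t) ^ 2 / (2 * h ^ 2) := by positivity
    linarith
  set a := ∫ t in (0 : ℝ)..R, f t ^ 2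
  set b := ∫ t in (0 : ℝ)..R, f' t ^ 2
  set c := ∫ t in (0 : ℝ)..R, f'' t ^ 2
  have hRh : 1 / R ≤ 1 / h := one_div_le_one_div_of_le hh hhR
  have hend : ∀ x ∈ Icc 0 R, |f x * f' x| ≤ 260 * (a / h ^ 2) + 3 / 16 * b + h ^ 2 * c / 16 := by
    intro x hx
    have h1 := sq_le_integral_sq_add_integral_deriv_sq hR hf' hd (r := h / 64) (by positivity) hx
    have h2 := sq_le_integral_sq_add_integral_deriv_sq hR hf'' hd' (r := h) hh hx
    have h3 : f x ^ 2 ≤ 65 / h * a + h / 64 * b := by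
      have : (1 / R + 1 / (h / 64)) * a ≤ 65 / h * a := by
        refine mul_le_mul_of_nonneg_right ?_ ha0
        have : 1 / (h / 64) = 64 * (1 / h) := by field_simp
        have : 65 / h = 65 * (1 / h) := by ring
        linarith
      linarith
    have h4 : f' x ^ 2 ≤ 2 / h * b + h * c := by
      have : (1 / R + 1 / h) * b ≤ 2 / h * b := by
        refine mul_le_mul_of_nonneg_right ?_ hb0
        have : 2 / h = 2 * (1 / h) := by ring
        linarith
      linarith
    have h5 : |f x * f' x| ≤ 4 / h * f x ^ 2 + h / 16 * f' x ^ 2 := by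
      have e1 : 4 / h * f x ^ 2 + h / 16 * f' x ^ 2 - f x * f' x =
          (8 * f x - h * f' x) ^ 2 / (16 * h) := by field_simp; ring
      have e2 : 4 / h * f x ^ 2 + h / 16 * f' x ^ 2 + f x * f' x =
          (8 * f x + h * f' x) ^ 2 / (16 * h) := by field_simp; ring
      have e3 : 0 ≤ (8 * f x - h * f' x) ^ 2 / (16 * h) := by positivity
      have e4 : 0 ≤ (8 * f x + h * f' x) ^ 2 / (16 * h) := by positivity
      rw [abs_le]
      constructor <;> linarith
    calc |f x * f' x| ≤ 4 / h * f x ^ 2 + h / 16 * f' x ^ 2 := h5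
      _ ≤ 4 / h * (65 / h * a + h / 64 * b) + h / 16 * (2 / h * b + h * c) := by gcongr
      _ = 260 * (a / h ^ 2) + 3 / 16 * b + h ^ 2 * c / 16 := by field_simp; ring
  have e0 := (abs_le.1 (hend 0 ⟨le_rfl, hR.le⟩)).1
  have eR := (abs_le.1 (hend R ⟨hR.le, le_rfl⟩)).2
  have e1 : 1 / (2 * h ^ 2) * a = (a / h ^ 2) / 2 := by field_simp
  have e2 : 0 ≤ a / h ^ 2 := by positivity
  have e3 : 0 ≤ h ^ 2 * c := by positivity
  rw [e1] at hcross
  linarith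

/-- A sequence whose consecutive terms interpolate at every scale can be absorbed into the next
term and the initial term. -/
lemma exists_le_mul_succ_add_mul_zero {C : ℝ} (hC : 0 < C) (n : ℕ) :
    ∀ d : ℝ, 0 < d → ∃ K : ℝ, 0 ≤ K ∧ ∀ B : ℕ → ℝ, (∀ i, 0 ≤ B i) →
      (∀ i < n, ∀ s : ℝ, 0 < s → s ≤ 1 →
        B (i + 1) ≤ C * (s ^ 2 * B (i + 2) + B i / s ^ 2)) →
      B n ≤ d * B (n + 1) + K * B 0 := by
  induction n with
  | zero =>
    intro d hd
    exact ⟨1, zero_le_one, fun B hB _ => by nlinarith [mul_nonneg hd.le (hB 1)]⟩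
  | succ n ih =>
    intro d hd
    obtain ⟨s, hs0, hs1, hs⟩ : ∃ s : ℝ, 0 < s ∧ s ≤ 1 ∧ C * s ^ 2 ≤ d / 2 := by
      refine ⟨min 1 (d / (2 * C)), by positivity, min_le_left _ _, ?_⟩
      have h1 : min 1 (d / (2 * C)) ≤ 1 := min_le_left _ _
      have h2 : min 1 (d / (2 * C)) ≤ d / (2 * C) := min_le_right _ _
      have h0 : 0 < min 1 (d / (2 * C)) := by positivity
      calc C * min 1 (d / (2 * C)) ^ 2
          ≤ C * (min 1 (d / (2 * C)) * 1) := by rw [sq]; gcongr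
        _ ≤ C * (d / (2 * C) * 1) := by gcongr
        _ = d / 2 := by field_simp
    obtain ⟨K, hK0, hK⟩ := ih (s ^ 2 / (2 * C)) (by positivity)
    refine ⟨2 * C * K / s ^ 2, by positivity, fun B hB hstep => ?_⟩
    have h1 := hstep n n.lt_succ_self s hs0 hs1
    have h2 := hK B hB fun i hi => hstep i (hi.trans n.lt_succ_self)
    have h3 : C * (B n / s ^ 2) ≤ B (n + 1) / 2 + C * K / s ^ 2 * B 0 := by
      calc C * (B n / s ^ 2)
          ≤ C * ((s ^ 2 / (2 * C) * B (n + 1) + K * B 0) / s ^ 2) := by gcongr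
        _ = B (n + 1) / 2 + C * K / s ^ 2 * B 0 := by field_simp
    have h4 : C * s ^ 2 * B (n + 2) ≤ d / 2 * B (n + 2) :=
      mul_le_mul_of_nonneg_right hs (hB _)
    have h5 : 2 * C * K / s ^ 2 * B 0 = 2 * (C * K / s ^ 2 * B 0) := by ring
    have h6 : n + 1 + 1 = n + 2 := rfl
    rw [h5, h6]
    linarith

lemma exists_le_add_mul_zero {C : ℝ} (hC : 0 < C) (j d : ℕ) :
    ∃ K : ℝ, 0 ≤ K ∧ ∀ B : ℕ → ℝ, (∀ i, 0 ≤ B i) →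
      (∀ i, i + 2 ≤ j + d → ∀ s : ℝ, 0 < s → s ≤ 1 →
        B (i + 1) ≤ C * (s ^ 2 * B (i + 2) + B i / s ^ 2)) →
      B j ≤ B (j + d) + K * B 0 := by
  induction d with
  | zero => exact ⟨0, le_rfl, fun B _ _ => by simp⟩
  | succ d ih =>
    obtain ⟨K, hK0, hK⟩ := ih
    obtain ⟨K', hK'0, hK'⟩ := exists_le_mul_succ_add_mul_zero hC (j + d) 1 one_pos
    refine ⟨K + K', by positivity, fun B hB hstep => ?_⟩
    have h1 := hK B hB fun i hi => hstep i (by omega)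
    have h2 := hK' B hB fun i hi => hstep i (by omega)
    rw [← add_assoc]
    linarith

/-- Interpolation between `v` and its `l`-th derivative in `L²(0, R)`, at every scale `h ≤ R`. -/
lemma exists_integral_iteratedDerivWithin_sq_le {R : ℝ} (hR : 0 < R) {l j : ℕ} (hj : j < l) :
    ∃ C : ℝ, 0 < C ∧ ∀ v : ℝ → ℝ, ContDiffOn ℝ l v (Icc 0 R) → ∀ h : ℝ, 0 < h → h ≤ R →
      ∫ x in (0 : ℝ)..R, iteratedDerivWithin j v (Icc 0 R) x ^ 2 ≤
        C * (h ^ (2 * (l - j)) * (∫ x in (0 : ℝ)..R, iteratedDerivWithin l v (Icc 0 R) x ^ 2) +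
          (∫ x in (0 : ℝ)..R, v x ^ 2) / h ^ (2 * j)) := by
  obtain ⟨d, rfl⟩ := Nat.exists_eq_add_of_lt hj
  obtain ⟨K, hK0, hK⟩ := exists_le_add_mul_zero (C := 1000) (by norm_num) j (d + 1)
  refine ⟨1 + K, by positivity, fun v hv h hh hhR => ?_⟩
  have hU : UniqueDiffOn ℝ (Icc 0 R) := uniqueDiffOn_Icc hR
  have hderiv : ∀ i < j + d + 1, ∀ x ∈ Icc 0 R, HasDerivWithinAt
      (iteratedDerivWithin i v (Icc 0 R)) (iteratedDerivWithin (i + 1) v (Icc 0 R) x)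
      (Icc 0 R) x := by
    intro i hi x hx
    rw [iteratedDerivWithin_succ]
    exact (hv.differentiableOn_iteratedDerivWithin (by exact_mod_cast hi) hU x hx).hasDerivWithinAt
  set A : ℕ → ℝ := fun i => ∫ x in (0 : ℝ)..R, iteratedDerivWithin i v (Icc 0 R) x ^ 2 with hA
  have hA0 : ∀ i, 0 ≤ A i := fun i =>
    intervalIntegral.integral_nonneg hR.le fun t _ => sq_nonneg _
  have hAz : A 0 = ∫ x in (0 : ℝ)..R, v x ^ 2 := by simp [hA]
  have hmain := hK (fun i => h ^ (2 * i) * A i) (fun i => mul_nonneg (by positivity) (hA0 i))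
    (fun i hi s hs0 hs1 => ?_)
  · have e : j + d + 1 - j = d + 1 := by omega
    rw [e, ← hAz]
    change A j ≤ (1 + K) * (h ^ (2 * (d + 1)) * A (j + d + 1) + A 0 / h ^ (2 * j))
    have hp : 0 < h ^ (2 * j) := by positivity
    rw [← mul_le_mul_iff_right₀ hp]
    simp only [mul_zero, pow_zero, one_mul] at hmain
    have e2 : h ^ (2 * j) * ((1 + K) * (h ^ (2 * (d + 1)) * A (j + d + 1) + A 0 / h ^ (2 * j))) =
        (1 + K) * (h ^ (2 * (j + (d + 1))) * A (j + (d + 1)) + A 0) := by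
      rw [show 2 * (j + (d + 1)) = 2 * j + 2 * (d + 1) by ring, pow_add, ← add_assoc j d 1]
      field_simp
    rw [e2]
    have h1 : 0 ≤ h ^ (2 * (j + (d + 1))) * A (j + (d + 1)) :=
      mul_nonneg (by positivity) (hA0 _)
    nlinarith [mul_nonneg hK0 h1, hA0 0]
  · have hc : ContinuousOn (iteratedDerivWithin (i + 2) v (Icc 0 R)) (Icc 0 R) :=
      hv.continuousOn_iteratedDerivWithin (by exact_mod_cast hi) hU
    have := integral_deriv_sq_le_s14 hc (hderiv i (by omega)) (hderiv (i + 1) (by omega))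
      (mul_pos hs0 hh) ((mul_le_of_le_one_left hh.le hs1).trans hhR)
    change A (i + 1) ≤ 1000 * ((s * h) ^ 2 * A (i + 2) + A i / (s * h) ^ 2) at this
    calc h ^ (2 * (i + 1)) * A (i + 1)
        ≤ h ^ (2 * (i + 1)) * (1000 * ((s * h) ^ 2 * A (i + 2) + A i / (s * h) ^ 2)) := by gcongr
      _ = _ := by field_simp; ring

/-- Optimizing an interpolation inequality over the scale `h ≤ R`. -/
lemma exists_mul_le_of_forall_scale_s14 {R C ε : ℝ} (hR : 0 < R) (hC : 0 < C) (hε : 0 < ε)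
    {l j : ℕ} (hj : j < l) :
    ∃ c : ℝ, 0 < c ∧ ∀ T X Y Z : ℝ, 0 ≤ T → 0 ≤ Y → 0 ≤ Z →
      (∀ h : ℝ, 0 < h → h ≤ R → X ≤ C * (h ^ (2 * (l - j)) * Y + Z / h ^ (2 * j))) →
      T * X ≤ ε * Y + c * (T ^ ((l : ℝ) / ((l : ℝ) - j)) + T) * Z := by
  obtain ⟨d, rfl⟩ := Nat.exists_eq_add_of_lt hj
  have e : j + d + 1 - j = d + 1 := by omega
  have e' : ((j + d + 1 : ℕ) : ℝ) / (((j + d + 1 : ℕ) : ℝ) - j) = 1 + j / (d + 1 : ℝ) := by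
    push_cast
    rw [show (j : ℝ) + d + 1 - j = d + 1 by ring]
    field_simp
    ring
  rw [e, e']
  set p : ℝ := j / (d + 1 : ℝ) with hp
  refine ⟨C * (C / ε) ^ p + C / R ^ (2 * j), by positivity, fun T X Y Z hT hY hZ hX => ?_⟩
  have hTp : 0 ≤ T ^ (1 + p) := Real.rpow_nonneg hT _
  have hCp : 0 ≤ C * (C / ε) ^ p := by positivity
  have hCR : 0 ≤ C / R ^ (2 * j) := by positivity
  by_cases hcase : C * T * R ^ (2 * (d + 1)) ≤ ε
  · calc T * X ≤ T * (C * (R ^ (2 * (d + 1)) * Y + Z / R ^ (2 * j))) :=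
          mul_le_mul_of_nonneg_left (hX R hR le_rfl) hT
      _ = C * T * R ^ (2 * (d + 1)) * Y + C / R ^ (2 * j) * T * Z := by ring
      _ ≤ ε * Y + (C * (C / ε) ^ p + C / R ^ (2 * j)) * (T ^ (1 + p) + T) * Z := by
          gcongr
          · exact le_add_of_nonneg_left hCp
          · exact le_add_of_nonneg_left hTp
  · push Not at hcase
    have hT' : 0 < T := by
      rcases hT.eq_or_lt with h | h
      · rw [← h] at hcase; simp at hcase; linarith
      · exact h
    set q : ℝ := ε / (C * T) with hq
    have hq0 : 0 < q := by positivity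
    set h : ℝ := q ^ (1 / ((2 * (d + 1) : ℕ) : ℝ)) with hh
    have hh0 : 0 < h := Real.rpow_pos_of_pos hq0 _
    have hpow : h ^ (2 * (d + 1)) = q := by
      rw [hh, one_div, Real.rpow_inv_natCast_pow hq0.le (by omega)]
    have hhR : h ≤ R := by
      refine le_of_pow_le_pow_left₀ (n := 2 * (d + 1)) (by omega) hR.le ?_
      rw [hpow, hq, div_le_iff₀ (by positivity)]
      linarith
    have hpow' : h ^ (2 * j) = q ^ p := by
      rw [hh, ← Real.rpow_natCast, ← Real.rpow_mul hq0.le, hp]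
      congr 1
      push_cast
      field_simp
    have hqp : (q ^ p)⁻¹ = (C / ε) ^ p * T ^ p := by
      rw [← Real.inv_rpow hq0.le, ← Real.mul_rpow (by positivity) hT, hq, inv_div]
      congr 1
      ring
    calc T * X ≤ T * (C * (h ^ (2 * (d + 1)) * Y + Z / h ^ (2 * j))) :=
          mul_le_mul_of_nonneg_left (hX h hh0 hhR) hT
      _ = C * T * q * Y + C * (T * (q ^ p)⁻¹) * Z := by rw [hpow, hpow']; ring
      _ = ε * Y + C * (C / ε) ^ p * T ^ (1 + p) * Z := by
          rw [hqp, Real.rpow_add hT', Real.rpow_one, hq]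
          field_simp
      _ ≤ ε * Y + (C * (C / ε) ^ p + C / R ^ (2 * j)) * (T ^ (1 + p) + T) * Z := by
          gcongr
          · exact le_add_of_nonneg_right hCR
          · exact le_add_of_nonneg_right hT

/-- Interpolation with a weight: `M ^ (2 * b)` times the `L²` norm of an intermediate derivative. -/
lemma exists_rpow_mul_integral_iteratedDerivWithin_sq_le {R ε : ℝ} (hR : 0 < R) (hε : 0 < ε)
    {l j : ℕ} (hj : j < l) (b : ℝ) :
    ∃ c : ℝ, 0 < c ∧ ∀ M : ℝ, 0 ≤ M → ∀ v : ℝ → ℝ, ContDiffOn ℝ l v (Icc 0 R) →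
      M ^ (2 * b) * (∫ x in (0 : ℝ)..R, iteratedDerivWithin j v (Icc 0 R) x ^ 2) ≤
        ε * (∫ x in (0 : ℝ)..R, iteratedDerivWithin l v (Icc 0 R) x ^ 2) +
        c * (M ^ ((2 * (l : ℝ) * b) / ((l : ℝ) - (j : ℝ))) + M ^ (2 * b)) *
          ∫ x in (0 : ℝ)..R, v x ^ 2 := by
  obtain ⟨C, hC, hCv⟩ := exists_integral_iteratedDerivWithin_sq_le hR hj
  obtain ⟨c, hc, hcT⟩ := exists_mul_le_of_forall_scale_s14 hR hC hε hj
  refine ⟨c, hc, fun M hM v hv => ?_⟩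
  have h := hcT (M ^ (2 * b)) _ _ _ (Real.rpow_nonneg hM _)
    (intervalIntegral.integral_nonneg hR.le fun t _ => sq_nonneg _)
    (intervalIntegral.integral_nonneg hR.le fun t _ => sq_nonneg _) (hCv v hv)
  rw [← Real.rpow_mul hM] at h
  rwa [show 2 * (l : ℝ) * b / ((l : ℝ) - j) = 2 * b * ((l : ℝ) / ((l : ℝ) - j)) by ring]

lemma le_biSup_of_forall_le {s : Set ℝ} {f : ℝ → ℝ} {x : ℝ} (hx : x ∈ s) (h0 : 0 ≤ f x)
    (hf : ∀ y ∈ s, f y ≤ f x) : f x ≤ ⨆ y ∈ s, f y := by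
  have hb : BddAbove (range fun y => ⨆ _ : y ∈ s, f y) := by
    refine ⟨f x, ?_⟩
    rintro _ ⟨y, rfl⟩
    exact Real.iSup_le (hf y) h0
  refine le_trans ?_ (le_ciSup hb x)
  simp [hx]

/-- Estimate (3.26) of the paper; the constant `c(ε)` depends only on
`R, l, j, k, m, b', b''` and `ε`. -/
theorem estimate_3_26 (R : ℝ) (hR : 0 < R) (l j k m : ℕ) (hl : 1 ≤ l)
    (hj : j < l) (hk : k < l) (hm : m < l) (b' b'' : ℝ) (hb'0 : 0 ≤ b')
    (hb' : b' ≤ (2 * (l : ℝ) - 2 * (j : ℝ)) / (2 * (m : ℝ) + 1))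
    (hb''0 : 0 ≤ b'') (hb'' : b'' ≤ (2 * (l : ℝ) - 2 * (k : ℝ)) / (2 * (m : ℝ) + 1)) :
    ∀ ε : ℝ, 0 < ε → ∃ c : ℝ, 0 < c ∧
      ∀ u v w : ℝ → ℝ, ContDiffOn ℝ l u (Icc 0 R) → ContDiffOn ℝ l v (Icc 0 R) →
        ContDiffOn ℝ l w (Icc 0 R) →
        (∫ x in (0:ℝ)..R, |iteratedDerivWithin m u (Icc 0 R) x| ^ (b' + b'') *
            |iteratedDerivWithin k w (Icc 0 R) x| * |iteratedDerivWithin j v (Icc 0 R) x|) ≤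
          ε * (∫ x in (0:ℝ)..R, (iteratedDerivWithin l v (Icc 0 R) x) ^ 2) +
            c * ((⨆ x ∈ Icc (0:ℝ) R, |iteratedDerivWithin m u (Icc 0 R) x| ^
                    ((2 * (l : ℝ) * b') / ((l : ℝ) - (j : ℝ)))) +
                 (⨆ x ∈ Icc (0:ℝ) R, |iteratedDerivWithin m u (Icc 0 R) x| ^ (2 * b'))) *
              (∫ x in (0:ℝ)..R, (v x) ^ 2 * (1 + x)) +
            c * (∫ x in (0:ℝ)..R, (iteratedDerivWithin l w (Icc 0 R) x) ^ 2) +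
            c * ((⨆ x ∈ Icc (0:ℝ) R, |iteratedDerivWithin m u (Icc 0 R) x| ^
                    ((2 * (l : ℝ) * b'') / ((l : ℝ) - (k : ℝ)))) +
                 (⨆ x ∈ Icc (0:ℝ) R, |iteratedDerivWithin m u (Icc 0 R) x| ^ (2 * b''))) *
              ∫ x in (0:ℝ)..R, (w x) ^ 2 := by
  intro ε hε
  obtain ⟨c₁, hc₁, h₁⟩ := exists_rpow_mul_integral_iteratedDerivWithin_sq_le hR hε hj b'
  obtain ⟨c₂, hc₂, h₂⟩ := exists_rpow_mul_integral_iteratedDerivWithin_sq_le hR one_pos hk b''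
  refine ⟨c₁ + c₂ + 1, by positivity, fun u v w hu hv hw => ?_⟩
  have hU : UniqueDiffOn ℝ (Icc 0 R) := uniqueDiffOn_Icc hR
  have hcont : ∀ {i : ℕ} {f : ℝ → ℝ}, i < l → ContDiffOn ℝ l f (Icc 0 R) →
      ContinuousOn (iteratedDerivWithin i f (Icc 0 R)) (Icc 0 R) := fun hi hf =>
    hf.continuousOn_iteratedDerivWithin (by exact_mod_cast hi.le) hU
  have hii : ∀ {g : ℝ → ℝ}, ContinuousOn g (Icc 0 R) → IntervalIntegrable g volume 0 R :=
    fun {g} hg => (uIcc_of_le hR.le ▸ hg : ContinuousOn g (uIcc 0 R)).intervalIntegrable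
  have hsq : ∀ {g : ℝ → ℝ}, ContinuousOn g (Icc 0 R) →
      IntervalIntegrable (fun t => g t ^ 2) volume 0 R := fun hg => hii (hg.pow 2)
  have hum := hcont hm hu
  have hvj := hcont hj hv
  have hwk := hcont hk hw
  obtain ⟨x₀, hx₀, hmax⟩ := isCompact_Icc.exists_isMaxOn (nonempty_Icc.2 hR.le) hum.abs
  set M : ℝ := |iteratedDerivWithin m u (Icc 0 R) x₀| with hM
  have hM0 : 0 ≤ M := abs_nonneg _
  have hsup : ∀ p : ℝ, 0 ≤ p →
      M ^ p ≤ ⨆ x ∈ Icc (0:ℝ) R, |iteratedDerivWithin m u (Icc 0 R) x| ^ p := fun p hp =>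
    le_biSup_of_forall_le (f := fun x => |iteratedDerivWithin m u (Icc 0 R) x| ^ p) hx₀
      (by positivity) fun y hy => Real.rpow_le_rpow (abs_nonneg _) (hmax hy) hp
  have hlj : (0 : ℝ) < (l : ℝ) - j := sub_pos.2 (by exact_mod_cast hj)
  have hlk : (0 : ℝ) < (l : ℝ) - k := sub_pos.2 (by exact_mod_cast hk)
  have hlhs : (∫ x in (0:ℝ)..R, |iteratedDerivWithin m u (Icc 0 R) x| ^ (b' + b'') *
        |iteratedDerivWithin k w (Icc 0 R) x| * |iteratedDerivWithin j v (Icc 0 R) x|) ≤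
      M ^ (2 * b') * (∫ x in (0 : ℝ)..R, iteratedDerivWithin j v (Icc 0 R) x ^ 2) +
      M ^ (2 * b'') * (∫ x in (0 : ℝ)..R, iteratedDerivWithin k w (Icc 0 R) x ^ 2) := by
    rw [← intervalIntegral.integral_const_mul, ← intervalIntegral.integral_const_mul,
      ← intervalIntegral.integral_add ((hsq hvj).const_mul _)
        ((hsq hwk).const_mul _)]
    refine intervalIntegral.integral_mono_on hR.le
      (hii (((hum.abs.rpow_const fun _ _ => Or.inr (by positivity)).mul hwk.abs).mul hvj.abs))
      (((hsq hvj).const_mul _).add ((hsq hwk).const_mul _)) fun x hx => ?_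
    set y := iteratedDerivWithin j v (Icc 0 R) x
    set z := iteratedDerivWithin k w (Icc 0 R) x
    have hpow : ∀ b : ℝ, M ^ (2 * b) = (M ^ b) ^ 2 := fun b => by
      rw [mul_comm, Real.rpow_mul hM0]; norm_cast
    calc |iteratedDerivWithin m u (Icc 0 R) x| ^ (b' + b'') * |z| * |y|
        ≤ M ^ (b' + b'') * |z| * |y| := by
          gcongr
          exact hmax hx
      _ = (M ^ b' * |y|) * (M ^ b'' * |z|) := by
          rw [Real.rpow_add_of_nonneg hM0 hb'0 hb''0]; ring
      _ ≤ (M ^ b' * |y|) ^ 2 + (M ^ b'' * |z|) ^ 2 := by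
          nlinarith [sq_nonneg (M ^ b' * |y| - M ^ b'' * |z|), sq_nonneg (M ^ b' * |y|),
            sq_nonneg (M ^ b'' * |z|)]
      _ = M ^ (2 * b') * y ^ 2 + M ^ (2 * b'') * z ^ 2 := by
          rw [mul_pow, mul_pow, sq_abs, sq_abs, hpow, hpow]
  have hv2 : ∫ x in (0:ℝ)..R, v x ^ 2 ≤ ∫ x in (0:ℝ)..R, v x ^ 2 * (1 + x) := by
    refine intervalIntegral.integral_mono_on hR.le (hsq hv.continuousOn)
      (hii ((hv.continuousOn.pow 2).mul (by fun_prop))) fun x hx => ?_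
    nlinarith [mul_nonneg (sq_nonneg (v x)) hx.1]
  have hv0 : 0 ≤ ∫ x in (0:ℝ)..R, v x ^ 2 :=
    intervalIntegral.integral_nonneg hR.le fun t _ => sq_nonneg _
  have hw0 : 0 ≤ ∫ x in (0:ℝ)..R, w x ^ 2 :=
    intervalIntegral.integral_nonneg hR.le fun t _ => sq_nonneg _
  have hwl0 : 0 ≤ ∫ x in (0:ℝ)..R, iteratedDerivWithin l w (Icc 0 R) x ^ 2 :=
    intervalIntegral.integral_nonneg hR.le fun t _ => sq_nonneg _
  refine hlhs.trans ((add_le_add (h₁ M hM0 v hv) (h₂ M hM0 w hw)).trans ?_)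
  rw [← add_assoc]
  have hp₁ : 0 ≤ 2 * (l : ℝ) * b' / ((l : ℝ) - j) := by positivity
  have hp₂ : 0 ≤ 2 * (l : ℝ) * b'' / ((l : ℝ) - k) := by positivity
  have hS₁ := add_le_add (hsup _ hp₁) (hsup (2 * b') (by positivity))
  have hS₂ := add_le_add (hsup _ hp₂) (hsup (2 * b'') (by positivity))
  have hS₁0 := (add_nonneg (Real.rpow_nonneg hM0 _) (Real.rpow_nonneg hM0 _)).trans hS₁
  have hS₂0 := (add_nonneg (Real.rpow_nonneg hM0 _) (Real.rpow_nonneg hM0 _)).trans hS₂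
  refine add_le_add (add_le_add (add_le_add le_rfl ?_) ?_) ?_
  · refine mul_le_mul (mul_le_mul (by linarith) hS₁ (by positivity) (by positivity)) hv2 hv0 ?_
    exact mul_nonneg (by positivity) hS₁0
  · exact mul_le_mul_of_nonneg_right (by linarith) hwl0
  · exact mul_le_mul_of_nonneg_right
      (mul_le_mul (by linarith) hS₂ (by positivity) (by positivity)) hw0
end
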